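/- arXiv:1307.3042 — 2 statements merged into one kernel-verified Lean document; each statement's English description precedes it below -/
import Mathlib

section
/- Let f be a transcendental meromorphic function in the plane such that all singular values of f⁻¹ lie in the finite set {a₁, …, a_κ} ⊆ ℂ∞. Then there exist R > 0 and ρ₀ > 0, depending on f, with the following property. Let 0 < ρ < ρ₀, let α ∈ ℂ∞, and let E ⊆ {z ∈ ℂ : R < |z| < ∞} be a connected set such that χ(f(z), α) < ρ² for all z ∈ E. Then at least one of the following holds: (i) E lies in a component of the set {z ∈ ℂ : χ(f(z), a_j) < 2ρ} for some j; (ii) E lies in a simply connected subdomain of ℂ \ {0} and has logarithmic diameter at most 400πρ. -/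
open Filter Set Topology Bornology MeasureTheory

noncomputable section

/-! ### The extended plane and the chordal metric

ℂ∞ is modelled as `Option ℂ`, with `none` denoting the point ∞. -/

/-- The chordal metric χ on the extended complex plane ℂ∞ (`none` = ∞). -/
def chordal : Option ℂ → Option ℂ → ℝ
  | Option.none, Option.none => 0
  | Option.none, Option.some w => 1 / Real.sqrt (1 + ‖w‖ ^ 2)
  | Option.some z, Option.none => 1 / Real.sqrt (1 + ‖z‖ ^ 2)
  | Option.some z, Option.some w =>
      ‖z - w‖ / Real.sqrt ((1 + ‖z‖ ^ 2) * (1 + ‖w‖ ^ 2))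

/-! ### Meromorphic functions in the plane -/

/-- `f` is meromorphic on the plane with pole set `P`: poles form a discrete closed set,
`f` is analytic off `P`, and `|f| → ∞` at each point of `P`. -/
def MeroPlane (f : ℂ → ℂ) (P : Set ℂ) : Prop :=
  (∀ K : Set ℂ, IsCompact K → (P ∩ K).Finite) ∧
  (∀ z ∉ P, AnalyticAt ℂ f z) ∧
  ∀ p ∈ P, Tendsto (fun z => ‖f z‖) (nhdsWithin p Pᶜ) atTop

/-- `f` coincides with a rational function away from its poles. -/
def RationalFn (f : ℂ → ℂ) (P : Set ℂ) : Prop :=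
  ∃ p q : Polynomial ℂ, q ≠ 0 ∧ ∀ z ∉ P, q.eval z ≠ 0 → f z = p.eval z / q.eval z

/-- `f` is a transcendental meromorphic function in the plane, with pole set `P`. -/
def TranscMeroPlane (f : ℂ → ℂ) (P : Set ℂ) : Prop :=
  MeroPlane f P ∧ ¬ RationalFn f P

/-- `f` has a pole of order `m` at `z₀`. -/
def PoleOrder (f : ℂ → ℂ) (z₀ : ℂ) (m : ℕ) : Prop :=
  0 < m ∧ ∃ g : ℂ → ℂ, AnalyticAt ℂ g z₀ ∧ g z₀ ≠ 0 ∧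
    ∀ᶠ z in nhdsWithin z₀ {z₀}ᶜ, f z = g z / (z - z₀) ^ m

/-- `f` has a zero of order `m` at `z₀`. -/
def ZeroOrder (f : ℂ → ℂ) (z₀ : ℂ) (m : ℕ) : Prop :=
  0 < m ∧ ∃ g : ℂ → ℂ, AnalyticAt ℂ g z₀ ∧ g z₀ ≠ 0 ∧
    ∀ᶠ z in nhds z₀, f z = (z - z₀) ^ m * g z

/-- `z₀` is a multiple point of `f` of multiplicity `μ`: either a pole of `f` of order `μ ≥ 2`,
or a point of analyticity where `f'` has a zero of order `μ - 1`. -/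
def MultiplePointWithMult (f : ℂ → ℂ) (z₀ : ℂ) (μ : ℕ) : Prop :=
  2 ≤ μ ∧ (PoleOrder f z₀ μ ∨ (AnalyticAt ℂ f z₀ ∧ ZeroOrder (deriv f) z₀ (μ - 1)))

/-- `z₀` is a multiple point of `f`. -/
def MultiplePoint (f : ℂ → ℂ) (z₀ : ℂ) : Prop :=
  ∃ μ, MultiplePointWithMult f z₀ μ

open scoped Classical in
/-- The value of `f` at `z` as an element of ℂ∞, given the pole set `P`. -/
def valueAt (f : ℂ → ℂ) (P : Set ℂ) (z : ℂ) : Option ℂ :=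
  if z ∈ P then none else some (f z)

/-- The set of critical values of `f` in ℂ∞ (values at multiple points). -/
def CriticalValues (f : ℂ → ℂ) (P : Set ℂ) : Set (Option ℂ) :=
  {w | ∃ z, MultiplePoint f z ∧ w = valueAt f P z}

/-! ### Transcendental singularities of the inverse function -/

/-- A path tending to infinity on which `f → a`; such a path determines a transcendental
singularity of `f⁻¹` over `a`. -/
def AsymptoticPath (f : ℂ → ℂ) (P : Set ℂ) (a : Option ℂ) (γ : ℝ → ℂ) : Prop :=
  ContinuousOn γ (Ici 0) ∧
  Tendsto (fun t => ‖γ t‖) atTop atTop ∧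
  Tendsto (fun t => chordal (valueAt f P (γ t)) a) atTop (nhds 0)

/-- `C` is a connected component of the set `S`. -/
def IsComponentOf (C S : Set ℂ) : Prop :=
  ∃ x ∈ S, C = connectedComponentIn S x

/-- The paths `γ₁`, `γ₂`, with asymptotic values `a₁`, `a₂` respectively, determine
distinct transcendental singularities of `f⁻¹`. -/
def DistinctSingularities (f : ℂ → ℂ) (P : Set ℂ) (a₁ a₂ : Option ℂ) (γ₁ γ₂ : ℝ → ℂ) : Prop :=
  a₁ ≠ a₂ ∨ ∃ t : ℝ, 0 < t ∧ ∃ C₁ C₂ : Set ℂ,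
    IsComponentOf C₁ {z | chordal (valueAt f P z) a₁ < t} ∧
    IsComponentOf C₂ {z | chordal (valueAt f P z) a₂ < t} ∧
    Disjoint C₁ C₂ ∧
    IsBounded (γ₁ '' Ici 0 \ C₁) ∧ IsBounded (γ₂ '' Ici 0 \ C₂)

/-- The inverse function of `f` has finitely many transcendental singularities: there is a
bound `n` on the size of any family of pairwise distinct transcendental singularities. -/
def FinitelyManyTranscSing (f : ℂ → ℂ) (P : Set ℂ) : Prop :=
  ∃ n : ℕ, ∀ m : ℕ, ∀ a : Fin m → Option ℂ, ∀ γ : Fin m → ℝ → ℂ,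
    (∀ i, AsymptoticPath f P (a i) (γ i)) →
    (∀ i j, i ≠ j → DistinctSingularities f P (a i) (a j) (γ i) (γ j)) →
    m ≤ n

/-- The Schwarzian derivative `S_f = f'''/f' - (3/2)(f''/f')²`. -/
def schwarzian (f : ℂ → ℂ) (z : ℂ) : ℂ :=
  deriv (deriv (deriv f)) z / deriv f z - (3 / 2) * (deriv (deriv f) z / deriv f z) ^ 2

/-- `w` is a singular value of `f⁻¹`: a critical value or an asymptotic value of `f`. -/
def SingularValue (f : ℂ → ℂ) (P : Set ℂ) (w : Option ℂ) : Prop :=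
  w ∈ CriticalValues f P ∨ ∃ γ : ℝ → ℂ, AsymptoticPath f P w γ

/-! ### Nevanlinna theory -/

open scoped Classical in
/-- The order of the pole of `f` at `z` (junk value `0` if there is no pole). -/
def poleOrderAt (f : ℂ → ℂ) (z : ℂ) : ℕ :=
  if h : ∃ m, PoleOrder f z m then h.choose else 0

/-- `n(t, f)`: the number of poles of `f` of modulus at most `t`, counted with multiplicity. -/
def nCount (f : ℂ → ℂ) (t : ℝ) : ℕ :=
  ∑ᶠ z ∈ {w : ℂ | ‖w‖ ≤ t}, poleOrderAt f z

/-- `N(r, f)`: the integrated counting function of the poles of `f`. -/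
def nevN (f : ℂ → ℂ) (r : ℝ) : ℝ :=
  (nCount f 0 : ℝ) * Real.log r + ∫ t in (0:ℝ)..r, ((nCount f t : ℝ) - (nCount f 0 : ℝ)) / t

/-- `m(r, f)`: the Nevanlinna proximity function. -/
def nevm (f : ℂ → ℂ) (r : ℝ) : ℝ :=
  (1 / (2 * Real.pi)) * ∫ θ in (0:ℝ)..(2 * Real.pi),
    Real.log (max 1 (‖f (r * Complex.exp (θ * Complex.I))‖))

/-- `T(r, f)`: the Nevanlinna characteristic. -/
def nevT (f : ℂ → ℂ) (r : ℝ) : ℝ := nevm f r + nevN f r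

/-- The order of growth `ρ(f) = limsup_{r→∞} log T(r,f)/log r`, as an extended real. -/
def growthOrder (f : ℂ → ℂ) : EReal :=
  Filter.limsup (fun r : ℝ => ((Real.log (nevT f r) / Real.log r : ℝ) : EReal)) atTop

/-- ∞ is a Borel exceptional value of `f`. -/
def BorelExceptionalInfty (f : ℂ → ℂ) : Prop :=
  Filter.limsup (fun r : ℝ => ((Real.log (nevN f r) / Real.log r : ℝ) : EReal)) atTop <
  Filter.limsup (fun r : ℝ => ((Real.log (nevT f r) / Real.log r : ℝ) : EReal)) atTop

/-! ### Meromorphic functions near infinity and the Wiman-Valiron property -/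

/-- `A` is meromorphic in `R ≤ |z| < ∞` with pole set `P`. -/
def MeroAnnulus (A : ℂ → ℂ) (R : ℝ) (P : Set ℂ) : Prop :=
  P ⊆ {z : ℂ | R ≤ ‖z‖} ∧
  (∀ K : Set ℂ, IsCompact K → (P ∩ K).Finite) ∧
  (∀ z : ℂ, R < ‖z‖ → z ∉ P → AnalyticAt ℂ A z) ∧
  ∀ p ∈ P, Tendsto (fun z => ‖A z‖) (nhdsWithin p Pᶜ) atTop

/-- `A` (meromorphic near ∞ with pole set `P`) has an essential singularity at infinity:
it is not the case that the poles are bounded and `A(z) ~ c zⁿ` as `z → ∞`. -/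
def EssSingAtInfty (A : ℂ → ℂ) (P : Set ℂ) : Prop :=
  ¬ (IsBounded P ∧ ∃ (n : ℤ) (c : ℂ), c ≠ 0 ∧
      Tendsto (fun z : ℂ => A z / z ^ n)
        (Filter.comap (fun z : ℂ => ‖z‖) atTop ⊓ Filter.principal Pᶜ) (nhds c))

/-- The logarithmic rectangle `D(z_r, L)` of Definition 2.1. -/
def WVDisk (z₀ : ℂ) (Nr phir L : ℝ) : Set ℂ :=
  {z : ℂ | ∃ τ : ℂ, z = z₀ * Complex.exp τ ∧
    |τ.re| ≤ L * phir / Nr ∧ |τ.im| ≤ L * phir / Nr}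

/-- Data witnessing the Wiman-Valiron property for `A`, meromorphic in `R ≤ |z| < ∞`:
an unbounded set `F1 ⊆ [R,∞)`, functions `N : F1 → [2,∞)`, `phi : F1 → [1,∞)` and points
`zr r` with `|zr r| = r`, such that `N(r) → ∞`, `phi(r)/N(r) → 0`, `phi(r)/log N(r) → ∞`,
`phi(r) = o(log⁺ |A(zr r)|)`, and `A(z) ~ (z/zr r)^{N(r)} A(zr r)` on `D(zr r, 8)`,
uniformly as `r → ∞` in `F1`.  (For `z = zr r · e^τ` one has `(z/zr r)^{N(r)} = e^{N(r)τ}`.) -/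
structure WVData (A : ℂ → ℂ) (R : ℝ) where
  F1 : Set ℝ
  N : ℝ → ℝ
  phi : ℝ → ℝ
  zr : ℝ → ℂ
  F1_sub : F1 ⊆ Ici R
  F1_unbounded : ∀ c : ℝ, ∃ r ∈ F1, c < r
  N_ge : ∀ r ∈ F1, 2 ≤ N r
  phi_ge : ∀ r ∈ F1, 1 ≤ phi r
  N_tendsto : Tendsto N (atTop ⊓ Filter.principal F1) atTop
  phi_over_N : Tendsto (fun r => phi r / N r) (atTop ⊓ Filter.principal F1) (nhds 0)
  phi_over_logN : Tendsto (fun r => phi r / Real.log (N r)) (atTop ⊓ Filter.principal F1) atTop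
  zr_abs : ∀ r ∈ F1, ‖zr r‖ = r
  phi_small : Tendsto (fun r => phi r / Real.log (max 1 (‖A (zr r)‖)))
      (atTop ⊓ Filter.principal F1) (nhds 0)
  approx : ∀ ε : ℝ, 0 < ε → ∀ᶠ r in atTop ⊓ Filter.principal F1, ∀ τ : ℂ,
      |τ.re| ≤ 8 * phi r / N r → |τ.im| ≤ 8 * phi r / N r →
      ‖A (zr r * Complex.exp τ) - Complex.exp ((N r : ℂ) * τ) * A (zr r)‖
        ≤ ε * ‖Complex.exp ((N r : ℂ) * τ) * A (zr r)‖

/-- `A` has the Wiman-Valiron property (Definition 2.1). -/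
def HasWVProp (A : ℂ → ℂ) (R : ℝ) : Prop := Nonempty (WVData A R)

/-- The point `w_r = z_r exp(-4 phi(r)/N(r))`. -/
def WVwr {A : ℂ → ℂ} {R : ℝ} (W : WVData A R) (r : ℝ) : ℂ :=
  W.zr r * Complex.exp (((-(4 * W.phi r / W.N r) : ℝ) : ℂ))

/-- The quantity `Z_r = |2 z_r A(z_r)^{1/2} / (N(r)+2)|`. -/
def WVZr {A : ℂ → ℂ} {R : ℝ} (W : WVData A R) (r : ℝ) : ℝ :=
  2 * r * Real.sqrt (‖A (W.zr r)‖) / (W.N r + 2)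

/-- The data of an analytic branch `sqA r` of `A^{1/2}` on `D(z_r, 4)` together with the
primitive `Z r` of `A^{1/2}` with `Z r (w_r) = 2 w_r A(w_r)^{1/2}/(N+2)`; this encodes
`Z(z) = 2 w_r A(w_r)^{1/2}/(N+2) + ∫_{w_r}^z A(t)^{1/2} dt`. -/
def IsZData {A : ℂ → ℂ} {R : ℝ} (W : WVData A R) (sqA Z : ℝ → ℂ → ℂ) (r : ℝ) : Prop :=
  (∀ z ∈ WVDisk (W.zr r) (W.N r) (W.phi r) 4,
      (sqA r z) ^ 2 = A z ∧ AnalyticAt ℂ (sqA r) z ∧ HasDerivAt (Z r) (sqA r z) z) ∧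
  Z r (WVwr W r) = 2 * WVwr W r * sqA r (WVwr W r) / ((W.N r : ℂ) + 2)

/-- The closed logarithmic rectangle `J₁ = {Z : |log|Z/Z_r|| ≤ phi(r), |arg Z| ≤ π/4}`. -/
def J1 (Zr phir : ℝ) : Set ℂ :=
  {w : ℂ | w ≠ 0 ∧ |Real.log (‖w‖ / Zr)| ≤ phir ∧ |Complex.arg w| ≤ Real.pi / 4}

/-! ### ε-sets -/

/-- An ε-set: a countable union of discs `B(b_j, ρ_j)` with `|b_j| → ∞` and
`Σ ρ_j/|b_j| < ∞`. -/
def IsEpsilonSet (E : Set ℂ) : Prop :=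
  ∃ (b : ℕ → ℂ) (ρ : ℕ → ℝ), (∀ j, 0 ≤ ρ j) ∧
    Tendsto (fun j => ‖b j‖) atTop atTop ∧
    Summable (fun j => ρ j / ‖b j‖) ∧
    E = ⋃ j, Metric.ball (b j) (ρ j)



def HasLift {X : Type*} [TopologicalSpace X] (p : X → ℂ) (x₀ : X) (ζ : ℂ) (T : ℝ) (γ : ℝ → X) : Prop :=
  ContinuousOn γ (Icc 0 T) ∧ γ 0 = x₀ ∧ ∀ t ∈ Icc 0 T, p (γ t) = t * ζ

theorem lift_extend {X : Type*} [TopologicalSpace X] {p : X → ℂ}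
    {x₀ : X} {ζ : ℂ} {t₁ t₂ : ℝ} {γ : ℝ → X} (h0 : 0 ≤ t₁) (h12 : t₁ ≤ t₂) (hγ : HasLift p x₀ ζ t₁ γ)
    (e : OpenPartialHomeomorph X ℂ) (he : p = e) (hs : γ t₁ ∈ e.source)
    (ht : ∀ t ∈ Icc t₁ t₂, (t : ℂ) * ζ ∈ e.target) : ∃ γ', HasLift p x₀ ζ t₂ γ' := by
  obtain ⟨hc, h00, hp⟩ := hγ
  refine ⟨fun t => if t ≤ t₁ then γ t else e.symm (t * ζ), ?_, ?_, ?_⟩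
  · refine ContinuousOn.if ?_ ?_ ?_
    · intro a ha
      have ha' : a = t₁ := by
        have := frontier_le_subset_eq continuous_id continuous_const ha.2
        simpa using this
      subst ha'
      have := hp a ⟨h0, le_rfl⟩
      rw [← this, he, e.left_inv hs]
    · refine hc.mono ?_
      rintro a ⟨ha, ha2⟩
      have : a ∈ {a | a ≤ t₁} := by
        rwa [(isClosed_le continuous_id continuous_const : IsClosed {a : ℝ | a ≤ t₁}).closure_eq] at ha2
      exact ⟨ha.1, this⟩
    · refine e.symm.continuousOn.comp (by fun_prop) ?_
      rintro a ⟨ha, ha2⟩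
      refine ht a ⟨?_, ha.2⟩
      have : a ∈ closure {a : ℝ | t₁ < a} := by simpa using ha2
      exact closure_lt_subset_le continuous_const continuous_id this
  · simp [h0, h00]
  · intro t htt
    by_cases h : t ≤ t₁
    · simp only [h, if_true]; exact hp t ⟨htt.1, h⟩
    · simp only [h, if_false]
      rw [he, e.right_inv (ht t ⟨(not_le.1 h).le, htt.2⟩)]

theorem exists_lift_path {X : Type*} [TopologicalSpace X] [T2Space X] {p : X → ℂ}
    (hp : IsLocalHomeomorph p) {x₀ : X} (hx₀ : p x₀ = 0) {ζ : ℂ}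
    (H : ∀ T : ℝ, 0 < T → T ≤ 1 → ∀ γ : ℝ → X, ContinuousOn γ (Ico 0 T) → γ 0 = x₀ →
      (∀ t ∈ Ico 0 T, p (γ t) = t * ζ) → ∃ x, MapClusterPt x (𝓝[<] T) γ) :
    ∃ γ, HasLift p x₀ ζ 1 γ := by
  have sep : IsSeparatedMap p := T2Space.isSeparatedMap p
  have inj := hp.isLocallyInjective
  haveI : Nonempty X := ⟨x₀⟩
  set S : Set ℝ := {T | T ∈ Icc (0:ℝ) 1 ∧ ∃ γ, HasLift p x₀ ζ T γ} with hS
  have h0S : (0:ℝ) ∈ S := by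
    refine ⟨by simp, fun _ => x₀, continuousOn_const, rfl, ?_⟩
    intro t ht
    have : t = 0 := le_antisymm ht.2 ht.1
    simp [this, hx₀]
  have hbdd : BddAbove S := ⟨1, fun x hx => hx.1.2⟩
  set T := sSup S with hT
  have hT0 : 0 ≤ T := le_csSup hbdd h0S
  have hT1 : T ≤ 1 := csSup_le ⟨0, h0S⟩ fun x hx => hx.1.2
  have hbelow : ∀ t, 0 ≤ t → t < T → ∃ γ, HasLift p x₀ ζ t γ := by
    intro t ht htT
    obtain ⟨t', ht', htt'⟩ := exists_lt_of_lt_csSup ⟨0, h0S⟩ htT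
    obtain ⟨γ, h1, h2, h3⟩ := ht'.2
    have : Icc 0 t ⊆ Icc 0 t' := Icc_subset_Icc_right htt'.le
    exact ⟨γ, h1.mono this, h2, fun s hs => h3 s (this hs)⟩
  -- point, time t₁, and chart
  obtain ⟨t₁, δ, e, γ, hδ, ht₁, ht₁T, hγ, he, hs, htar⟩ : ∃ (t₁ δ : ℝ) (e : OpenPartialHomeomorph X ℂ) (γ : ℝ → X),
      0 < δ ∧ 0 ≤ t₁ ∧ t₁ ≤ T ∧ HasLift p x₀ ζ t₁ γ ∧ p = e ∧ γ t₁ ∈ e.source ∧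
      ∀ t ∈ Icc t₁ (T + δ), (t:ℂ) * ζ ∈ e.target := by
    rcases hT0.eq_or_lt with hz | hpos
    · obtain ⟨e, hx, he⟩ := hp x₀
      have hopen : IsOpen ((fun t : ℝ => (t:ℂ) * ζ) ⁻¹' e.target) := e.open_target.preimage (by fun_prop)
      obtain ⟨δ, hδ, hb⟩ := Metric.isOpen_iff.1 hopen 0 (by
        have := e.map_source hx
        rw [← he, hx₀] at this
        simpa using this)
      obtain ⟨γ, hγ⟩ := h0S.2
      refine ⟨0, δ/2, e, γ, by linarith, le_rfl, hT0, hγ, he, by rw [hγ.2.1]; exact hx, ?_⟩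
      intro t ht
      apply hb
      rw [Metric.mem_ball, Real.dist_eq, sub_zero, abs_of_nonneg ht.1]
      linarith [ht.2]
    · choose! Γ hΓ using hbelow
      have huniq : ∀ t t', 0 ≤ t → t ≤ t' → t' < T → EqOn (Γ t) (Γ t') (Icc 0 t) := by
        intro t t' h0 htt ht'
        have hsub : Icc 0 t ⊆ Icc 0 t' := Icc_subset_Icc_right htt
        obtain ⟨a1, a2, a3⟩ := hΓ t h0 (htt.trans_lt ht')
        obtain ⟨b1, b2, b3⟩ := hΓ t' (h0.trans htt) ht'
        refine sep.eqOn_of_comp_eqOn inj isPreconnected_Icc a1 (b1.mono hsub) ?_ (a := 0) ⟨le_rfl, h0⟩ (by rw [a2, b2])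
        intro s hs
        simp only [Function.comp_apply]
        rw [a3 s hs, b3 s (hsub hs)]
      set γ : ℝ → X := fun t => Γ t t with hγd
      have hγe : ∀ t, 0 ≤ t → t < T → EqOn γ (Γ t) (Icc 0 t) := by
        intro t h0 ht s hs
        exact huniq s t hs.1 hs.2 ht ⟨hs.1, le_rfl⟩
      have hγl : ∀ t, 0 ≤ t → t < T → HasLift p x₀ ζ t γ := by
        intro t h0 ht
        obtain ⟨a1, a2, a3⟩ := hΓ t h0 ht
        refine ⟨a1.congr (hγe t h0 ht), ?_, ?_⟩
        · rw [hγe t h0 ht ⟨le_rfl, h0⟩, a2]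
        · intro s hs
          rw [hγe t h0 ht hs, a3 s hs]
      have hγc : ContinuousOn γ (Ico 0 T) := by
        intro t ht
        obtain ⟨t', h1, h2⟩ := exists_between ht.2
        have := (hγl t' (ht.1.trans h1.le) h2).1 t ⟨ht.1, h1.le⟩
        refine this.mono_of_mem_nhdsWithin ?_
        rw [mem_nhdsWithin]
        exact ⟨Iio t', isOpen_Iio, h1, fun s hs => ⟨hs.2.1, hs.1.le⟩⟩
      obtain ⟨x, hx⟩ := H T hpos hT1 γ hγc (hγl 0 le_rfl hpos).2.1
        (fun t ht => (hγl t ht.1 ht.2).2.2 t ⟨ht.1, le_rfl⟩)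
      have hpx : p x = T * ζ := by
        have h1 : MapClusterPt (p x) (𝓝[<] T) (p ∘ γ) := hx.continuousAt_comp hp.continuous.continuousAt
        have h2 : Tendsto (p ∘ γ) (𝓝[<] T) (𝓝 (T * ζ)) := by
          have h3 : Tendsto (fun t : ℝ => (t:ℂ) * ζ) (𝓝[<] T) (𝓝 (T * ζ)) :=
            ((by fun_prop : Continuous (fun t : ℝ => (t:ℂ) * ζ)).tendsto T).mono_left nhdsWithin_le_nhds
          refine h3.congr' ?_
          filter_upwards [Ioo_mem_nhdsLT hpos] with t ht
          exact ((hγl t ht.1.le ht.2).2.2 t ⟨ht.1.le, le_rfl⟩).symm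
        have h4 : ClusterPt (p x) (𝓝 (T * ζ)) := h1.clusterPt.mono h2
        exact eq_of_nhds_neBot h4
      obtain ⟨e, hxe, he⟩ := hp x
      have hopen : IsOpen ((fun t : ℝ => (t:ℂ) * ζ) ⁻¹' e.target) := e.open_target.preimage (by fun_prop)
      obtain ⟨δ, hδ, hb⟩ := Metric.isOpen_iff.1 hopen T (by
        have := e.map_source hxe
        rw [← he, hpx] at this
        simpa using this)
      have hfreq : ∃ᶠ t in 𝓝[<] T, γ t ∈ e.source :=
        hx.frequently (e.open_source.mem_nhds hxe)
      obtain ⟨t₁, h1, h2⟩ := (hfreq.and_eventually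
        (Ioo_mem_nhdsLT (show max 0 (T - δ) < T from max_lt hpos (by linarith)))).exists
      have h3 : 0 < t₁ := (le_max_left _ _).trans_lt h2.1
      have h4 : T - δ < t₁ := (le_max_right _ _).trans_lt h2.1
      refine ⟨t₁, δ/2, e, γ, by linarith, h3.le, h2.2.le, hγl t₁ h3.le h2.2, he, h1, ?_⟩
      intro t ht
      apply hb
      rw [Metric.mem_ball, Real.dist_eq, abs_lt]
      constructor <;> linarith [ht.1, ht.2]
  have hmin : t₁ ≤ min 1 (T + δ) := le_min (ht₁T.trans hT1) (by linarith)
  obtain ⟨γ', hγ'⟩ := lift_extend ht₁ hmin hγ e he hs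
    (fun t ht => htar t ⟨ht.1, ht.2.trans (min_le_right _ _)⟩)
  have hmem : min 1 (T + δ) ∈ S := ⟨⟨ht₁.trans hmin, min_le_left _ _⟩, γ', hγ'⟩
  have h5 : min 1 (T + δ) ≤ T := le_csSup hbdd hmem
  have h6 : min 1 (T+δ) = 1 := by
    rcases min_choice 1 (T + δ) with h | h
    · exact h
    · rw [h] at h5; linarith
  rw [h6] at hγ'
  exact ⟨γ', hγ'⟩

/-- inverse branch -/
theorem exists_branch {X : Type*} [TopologicalSpace X] [T2Space X] {p : X → ℂ}
    (hp : IsLocalHomeomorph p) {x₀ : X} (hx₀ : p x₀ = 0) {s : ℝ} (hs : 0 < s)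
    (H : ∀ ζ ∈ Metric.ball (0:ℂ) s, ∃ γ, HasLift p x₀ ζ 1 γ) :
    ∃ φ : Metric.ball (0:ℂ) s → X, IsOpenEmbedding φ ∧ (∀ w, p (φ w) = w) ∧
      φ ⟨0, Metric.mem_ball_self hs⟩ = x₀ := by
  have sep : IsSeparatedMap p := T2Space.isSeparatedMap p
  have inj := hp.isLocallyInjective
  haveI : Nonempty X := ⟨x₀⟩
  choose! Γ hΓ using H
  let f : C(unitInterval × Metric.ball (0:ℂ) s, ℂ) := ⟨fun q => (q.1 : ℝ) * (q.2 : ℂ), by fun_prop⟩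
  let g : unitInterval × Metric.ball (0:ℂ) s → X := fun q => Γ q.2 q.1
  have hcont : Continuous g := by
    refine hp.continuous_lift sep f ?_ ?_ ?_
    · ext q
      exact (hΓ q.2 q.2.2).2.2 q.1 q.1.2
    · have : (fun a => g ⟨0, a⟩) = fun _ => x₀ := by
        ext a
        exact (hΓ a a.2).2.1
      rw [this]; exact continuous_const
    · intro a
      exact (hΓ a a.2).1.comp_continuous continuous_subtype_val (fun t => t.2)
  refine ⟨fun w => g (1, w), ?_, ?_, ?_⟩
  · have hpw : p ∘ (fun w => g (1, w)) = Subtype.val := by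
      ext w
      have := (hΓ w w.2).2.2 1 (by simp)
      simpa [g] using this
    refine hp.isOpenEmbedding_of_comp ?_ (by fun_prop)
    rw [hpw]
    exact Metric.isOpen_ball.isOpenEmbedding_subtypeVal
  · intro w
    have := (hΓ w w.2).2.2 1 (by simp)
    simpa [g] using this
  · have h0 := hΓ 0 (Metric.mem_ball_self hs)
    have := sep.constOn_of_comp inj isPreconnected_Icc h0.1 (fun a ha a' ha' => by
      rw [h0.2.2 a ha, h0.2.2 a' ha']; simp) (a := 1) (a' := 0) (by simp) (by simp)
    simp only [g]
    simpa [h0.2.1] using this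

theorem landau_cover {g : ℂ → ℂ} {z₁ : ℂ} {d A : ℝ} (hd : 0 < d) (hA : 0 < A)
    (hg : DifferentiableOn ℂ g (Metric.ball z₁ d)) (hg1 : ‖deriv g z₁‖ = A)
    (hb : ∀ z ∈ Metric.ball z₁ d, ‖deriv g z‖ ≤ 2 * A) :
    Metric.ball (g z₁) (A * d / 24) ⊆ g '' Metric.ball z₁ d := by
  have hdg : DifferentiableOn ℂ (deriv g) (Metric.ball z₁ d) := hg.deriv Metric.isOpen_ball
  have hsch : ∀ z ∈ Metric.ball z₁ d, dist (deriv g z) (deriv g z₁) ≤ (3 * A) / d * dist z z₁ := by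
    intro z hz
    refine Complex.dist_le_div_mul_dist_of_mapsTo_ball hdg ?_ hz
    intro y hy
    rw [Metric.mem_closedBall, dist_eq_norm]
    calc ‖deriv g y - deriv g z₁‖ ≤ ‖deriv g y‖ + ‖deriv g z₁‖ := norm_sub_le _ _
      _ ≤ 3 * A := by linarith [hb y hy]
  have hsub : Metric.closedBall z₁ (d/6) ⊆ Metric.ball z₁ d := Metric.closedBall_subset_ball (by linarith)
  have hmv : ∀ z ∈ Metric.closedBall z₁ (d/6),
      ‖(g z - deriv g z₁ * z) - (g z₁ - deriv g z₁ * z₁)‖ ≤ (A / 2) * ‖z - z₁‖ := by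
    intro z hz
    refine (convex_closedBall z₁ (d/6)).norm_image_sub_le_of_norm_hasDerivWithin_le
      (f := fun z => g z - deriv g z₁ * z) (f' := fun z => deriv g z - deriv g z₁) ?_ ?_
      (Metric.mem_closedBall_self (by linarith)) hz
    · intro x hx
      have h1 : HasDerivAt g (deriv g x) x :=
        ((hg x (hsub hx)).differentiableAt (Metric.isOpen_ball.mem_nhds (hsub hx))).hasDerivAt
      have h2 : HasDerivAt (fun z : ℂ => deriv g z₁ * z) (deriv g z₁) x := by
        simpa using (hasDerivAt_id x).const_mul (deriv g z₁)
      exact (h1.sub h2).hasDerivWithinAt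
    · intro x hx
      have := hsch x (hsub hx)
      rw [dist_eq_norm] at this
      refine this.trans ?_
      have hx' : dist x z₁ ≤ d / 6 := hx
      calc 3 * A / d * dist x z₁ ≤ 3 * A / d * (d/6) := by gcongr
        _ = A / 2 := by field_simp; ring
  have key : ∀ z ∈ Metric.sphere z₁ (d/6), A * d / 12 ≤ ‖g z - g z₁‖ := by
    intro z hz
    have hz' : ‖z - z₁‖ = d / 6 := by simpa [dist_eq_norm] using hz
    have h1 := hmv z (Metric.sphere_subset_closedBall hz)
    have h2 : deriv g z₁ * (z - z₁) = (g z - g z₁) -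
      ((g z - deriv g z₁ * z) - (g z₁ - deriv g z₁ * z₁)) := by ring
    have h3 : ‖deriv g z₁ * (z - z₁)‖ = A * (d/6) := by rw [norm_mul, hg1, hz']
    rw [h2] at h3
    have h4 := norm_sub_le (g z - g z₁) ((g z - deriv g z₁ * z) - (g z₁ - deriv g z₁ * z₁))
    rw [hz'] at h1
    nlinarith
  have hdc : DiffContOnCl ℂ g (Metric.ball z₁ (d/6)) :=
    (hg.mono hsub).diffContOnCl_ball subset_rfl
  have hz1 : z₁ ∈ Metric.ball z₁ d := Metric.mem_ball_self hd
  have hgd : HasDerivAt g (deriv g z₁) z₁ :=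
    ((hg _ hz1).differentiableAt (Metric.isOpen_ball.mem_nhds hz1)).hasDerivAt
  have hne : deriv g z₁ ≠ 0 := by rw [← norm_pos_iff, hg1]; exact hA
  have hfreq : ∃ᶠ z in 𝓝 z₁, g z ≠ g z₁ :=
    ((hgd.eventually_ne hne).frequently).filter_mono nhdsWithin_le_nhds
  have := hdc.ball_subset_image_closedBall (by linarith) key hfreq
  have e : A * d / 12 / 2 = A * d / 24 := by ring
  rw [e] at this
  exact this.trans (image_mono hsub)

theorem landau_bound {g : ℂ → ℂ} {c : ℂ} {r B : ℝ} (hr : 0 < r)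
    (hg : DifferentiableOn ℂ g (Metric.ball c r))
    (hB : ∀ w t, Metric.ball w t ⊆ g '' Metric.ball c r → t ≤ B) :
    ‖deriv g c‖ * r ≤ 48 * B := by
  have main : ∀ r' : ℝ, 0 < r' → r' < r → ‖deriv g c‖ * r' ≤ 48 * B := by
    intro r' h0 hr'
    have hdg : DifferentiableOn ℂ (deriv g) (Metric.ball c r) := hg.deriv Metric.isOpen_ball
    have hsub : Metric.closedBall c r' ⊆ Metric.ball c r := Metric.closedBall_subset_ball hr'
    have hcont : ContinuousOn (fun z => ‖deriv g z‖ * (r' - dist z c)) (Metric.closedBall c r') :=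
      ((hdg.continuousOn.mono hsub).norm).mul (by fun_prop)
    obtain ⟨z₁, hz₁, hmax⟩ := (isCompact_closedBall c r').exists_isMaxOn
      (Metric.nonempty_closedBall.2 h0.le) hcont
    have hc := hmax (Metric.mem_closedBall_self h0.le)
    simp only [mem_ofPred_eq, dist_self, sub_zero] at hc
    have hB0 : 0 ≤ B := hB c 0 (by simp)
    rcases eq_or_ne (deriv g c) 0 with h | h
    · rw [h]; simp; exact hB0
    have hp : 0 < ‖deriv g c‖ * r' := by positivity
    have hM : 0 < ‖deriv g z₁‖ * (r' - dist z₁ c) := hp.trans_le hc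
    have hA : 0 < ‖deriv g z₁‖ := by
      rcases (norm_nonneg (deriv g z₁)).eq_or_lt with h' | h'
      · rw [← h'] at hM; simp at hM
      · exact h'
    have hd : 0 < r' - dist z₁ c := by
      by_contra hh
      push Not at hh
      nlinarith
    set d := r' - dist z₁ c with hdd
    have hs2 : Metric.ball z₁ (d/2) ⊆ Metric.closedBall c r' := by
      intro z hz
      rw [Metric.mem_ball] at hz
      rw [Metric.mem_closedBall]
      linarith [dist_triangle z z₁ c]
    have hcov := landau_cover (g := g) (z₁ := z₁) (d := d/2) (A := ‖deriv g z₁‖) (by linarith) hA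
      (hg.mono (hs2.trans hsub)) rfl (by
        intro z hz
        have h1 := hmax (hs2 hz)
        simp only [mem_ofPred_eq] at h1
        rw [Metric.mem_ball] at hz
        have h2 : d / 2 ≤ r' - dist z c := by linarith [dist_triangle z z₁ c]
        have h3 : ‖deriv g z‖ * (d/2) ≤ ‖deriv g z₁‖ * d :=
          (mul_le_mul_of_nonneg_left h2 (norm_nonneg _)).trans h1
        nlinarith)
    have := hB _ _ (hcov.trans (image_mono (hs2.trans hsub)))
    linarith
  have ht : Tendsto (fun r' => ‖deriv g c‖ * r') (𝓝[<] r) (𝓝 (‖deriv g c‖ * r)) :=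
    (((continuous_const.mul continuous_id).tendsto r)).mono_left nhdsWithin_le_nhds
  refine le_of_tendsto ht ?_
  filter_upwards [Ioo_mem_nhdsLT hr] with x hx using main x hx.1 hx.2

theorem log_bound {φ : ℂ → ℂ} {s t : ℝ} (hs : 0 < s) (hts : t < s)
    (hφ : DifferentiableOn ℂ φ (Metric.ball 0 s)) (hinj : InjOn φ (Metric.ball 0 s))
    (h0 : ∀ z ∈ Metric.ball (0:ℂ) s, φ z ≠ 0) 
    (hsm : 48 * Real.pi / (s - t) * (2 * t) < Real.pi) {u v : ℂ} (hu : u ∈ Metric.ball (0:ℂ) t)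
    (hv : v ∈ Metric.ball (0:ℂ) t) :
    ‖Complex.log (φ u / φ v)‖ ≤ 48 * Real.pi / (s - t) * (2 * t) := by
  obtain ⟨g, hg, hge⟩ : ∃ g : ℂ → ℂ, DifferentiableOn ℂ g (Metric.ball 0 s) ∧
      ∀ z ∈ Metric.ball (0:ℂ) s, Complex.exp (g z) = φ z := by
    have hq : DifferentiableOn ℂ (fun z => deriv φ z / φ z) (Metric.ball 0 s) :=
      (hφ.deriv Metric.isOpen_ball).div hφ h0
    have h00 : (0:ℂ) ∈ Metric.ball (0:ℂ) s := Metric.mem_ball_self hs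
    obtain ⟨G, hG0, hG⟩ := (hq.isExactOn_ball).with_val_at 0 (Complex.log (φ 0))
    refine ⟨G, fun z hz => (hG z hz).differentiableAt.differentiableWithinAt, ?_⟩
    have hconst : ∀ z ∈ Metric.ball (0:ℂ) s, φ z * Complex.exp (-G z) = φ 0 * Complex.exp (-G 0) := by
      intro z hz
      have hder : ∀ x ∈ Metric.ball (0:ℂ) s, HasDerivAt (fun z => φ z * Complex.exp (-G z)) 0 x := by
        intro x hx
        have h1 := ((hφ x hx).differentiableAt (Metric.isOpen_ball.mem_nhds hx)).hasDerivAt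
        have h2 := (hG x hx).neg.cexp
        have h3 := h1.mul h2
        refine h3.congr_deriv ?_
        have := h0 x hx
        field_simp
        simp
      exact Metric.isOpen_ball.is_const_of_deriv_eq_zero (convex_ball _ _).isPreconnected
        (fun x hx => (hder x hx).differentiableAt.differentiableWithinAt)
        (fun x hx => (hder x hx).deriv) hz h00
    intro z hz
    have h1 := hconst z hz
    rw [hG0, Complex.exp_neg, Complex.exp_neg, Complex.exp_log (h0 0 h00),
      mul_inv_cancel₀ (h0 0 h00)] at h1
    have := Complex.exp_ne_zero (G z)
    field_simp at h1
    exact h1.symm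
  have hder : ∀ z ∈ Metric.ball (0:ℂ) t, ‖deriv g z‖ ≤ 48 * Real.pi / (s - t) := by
    intro z hz
    have hz' : ‖z‖ < t := by simpa using hz
    have hsub : Metric.ball z (s - t) ⊆ Metric.ball (0:ℂ) s := by
      intro y hy
      rw [Metric.mem_ball] at hy ⊢
      have := dist_triangle y z 0
      rw [dist_zero_right z] at this
      linarith
    have := landau_bound (g := g) (c := z) (r := s - t) (B := Real.pi) (by linarith) (hg.mono hsub) (by
      intro w τ hτ
      by_contra hlt
      push Not at hlt
      obtain ⟨x, hx, hxe⟩ := hτ (show w + Real.pi * Complex.I ∈ Metric.ball w τ by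
        simp [abs_of_pos Real.pi_pos, hlt])
      obtain ⟨y, hy, hye⟩ := hτ (show w - Real.pi * Complex.I ∈ Metric.ball w τ by
        simp [dist_eq_norm, abs_of_pos Real.pi_pos, hlt])
      have e1 : φ x = φ y := by
        rw [← hge x (hsub hx), ← hge y (hsub hy), hxe, hye, sub_eq_add_neg, Complex.exp_add,
          Complex.exp_add, Complex.exp_neg, Complex.exp_pi_mul_I]
        norm_num
      have e2 := hinj (hsub hx) (hsub hy) e1
      rw [e2, hye] at hxe
      have h3 := congrArg Complex.im hxe
      simp at h3
      linarith [Real.pi_pos])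
    rw [le_div_iff₀ (by linarith)]
    exact this
  have ht0 : 0 < t := by
    have : ‖u‖ < t := by simpa using hu
    linarith [norm_nonneg u]
  have hst : Metric.ball (0:ℂ) t ⊆ Metric.ball 0 s := Metric.ball_subset_ball hts.le
  have hdist : ‖g u - g v‖ ≤ 48 * Real.pi / (s - t) * (2 * t) := by
    have h1 := (convex_ball (0:ℂ) t).norm_image_sub_le_of_norm_deriv_le (f := g)
      (fun x hx => (hg x (hst hx)).differentiableAt (Metric.isOpen_ball.mem_nhds (hst hx))) hder hv hu
    refine h1.trans ?_
    have : ‖u - v‖ ≤ 2 * t := by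
      have a1 : ‖u‖ < t := by simpa using hu
      have a2 : ‖v‖ < t := by simpa using hv
      linarith [norm_sub_le u v]
    have hp : 0 ≤ 48 * Real.pi / (s - t) := div_nonneg (by positivity) (by linarith)
    exact mul_le_mul_of_nonneg_left this hp
  rw [← hge u (hst hu), ← hge v (hst hv), ← Complex.exp_sub]
  have him : |(g u - g v).im| < Real.pi := (Complex.abs_im_le_norm _).trans_lt (hdist.trans_lt hsm)
  rw [abs_lt] at him
  rw [Complex.log_exp him.1 him.2.le]
  exact hdist

def hU : Option ℂ → ℂ
  | Option.none => 1
  | Option.some w => w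
def hV : Option ℂ → ℂ
  | Option.none => 0
  | Option.some _ => 1
def nn (p : Option ℂ) : ℝ := ‖hU p‖ ^ 2 + ‖hV p‖ ^ 2
def wdg (p q : Option ℂ) : ℂ := hU p * hV q - hV p * hU q
def mD (w p : Option ℂ) : ℂ := (starRingEnd ℂ) (hU w) * hU p + (starRingEnd ℂ) (hV w) * hV p
def mob (w p : Option ℂ) : ℂ := wdg p w / mD w p

theorem hU_none : hU none = 1 := rfl
theorem hV_none : hV none = 0 := rfl
theorem hU_some (w : ℂ) : hU (some w) = w := rfl
theorem hV_some (w : ℂ) : hV (some w) = 1 := rfl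

theorem nn_pos (p : Option ℂ) : 0 < nn p := by
  cases p <;> simp [nn, hU, hV]
  positivity

theorem nn_cast (p : Option ℂ) :
    ((nn p : ℝ) : ℂ) = (starRingEnd ℂ) (hU p) * hU p + (starRingEnd ℂ) (hV p) * hV p := by
  simp only [nn]
  push_cast
  rw [← Complex.conj_mul', ← Complex.conj_mul']

theorem chordal_eq (p q : Option ℂ) : chordal p q = ‖wdg p q‖ / Real.sqrt (nn p * nn q) := by
  cases p <;> cases q <;> simp [chordal, wdg, nn, hU, hV, add_comm]

theorem chordal_nonneg (p q : Option ℂ) : 0 ≤ chordal p q := by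
  rw [chordal_eq]; positivity

theorem chordal_comm (p q : Option ℂ) : chordal p q = chordal q p := by
  rw [chordal_eq, chordal_eq, mul_comm (nn p)]
  congr 1
  rw [← norm_neg]; congr 1; simp only [wdg]; ring

theorem chordal_eq_zero {p q : Option ℂ} : chordal p q = 0 ↔ p = q := by
  rw [chordal_eq, div_eq_zero_iff, norm_eq_zero]
  have : Real.sqrt (nn p * nn q) ≠ 0 := by
    have := nn_pos p; have := nn_pos q; positivity
  simp only [this, or_false]
  cases p <;> cases q <;> simp [wdg, hU, hV, sub_eq_zero]

theorem lagrange (w p : Option ℂ) : ‖wdg p w‖ ^ 2 + ‖mD w p‖ ^ 2 = nn w * nn p := by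
  have : (((‖wdg p w‖ ^ 2 + ‖mD w p‖ ^ 2 : ℝ)) : ℂ) = ((nn w * nn p : ℝ) : ℂ) := by
    push_cast
    rw [nn_cast, nn_cast, ← Complex.conj_mul', ← Complex.conj_mul']
    simp only [wdg, mD, map_add, map_sub, map_mul, Complex.conj_conj]
    ring
  exact_mod_cast this

theorem mD_le (w p : Option ℂ) : ‖mD w p‖ ≤ Real.sqrt (nn w * nn p) := by
  apply Real.le_sqrt_of_sq_le
  nlinarith [lagrange w p, sq_nonneg ‖wdg p w‖]

theorem chordal_triangle (p q r : Option ℂ) : chordal p r ≤ chordal p q + chordal q r := by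
  have hp := nn_pos p
  have hq := nn_pos q
  have hr := nn_pos r
  have id1 : wdg p r * (nn q : ℂ) = mD q r * wdg p q + mD q p * wdg q r := by
    rw [nn_cast]; simp only [wdg, mD]; ring
  have h1 : ‖wdg p r‖ * nn q ≤ Real.sqrt (nn q * nn r) * ‖wdg p q‖ + Real.sqrt (nn q * nn p) * ‖wdg q r‖ := by
    calc ‖wdg p r‖ * nn q = ‖wdg p r * (nn q : ℂ)‖ := by
          rw [norm_mul, Complex.norm_real, Real.norm_of_nonneg hq.le]
      _ ≤ ‖mD q r‖ * ‖wdg p q‖ + ‖mD q p‖ * ‖wdg q r‖ := by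
          rw [id1, ← norm_mul, ← norm_mul]; exact norm_add_le _ _
      _ ≤ _ := by gcongr <;> exact mD_le _ _
  rw [chordal_eq, chordal_eq, chordal_eq]
  rw [Real.sqrt_mul hq.le, Real.sqrt_mul hq.le] at h1
  rw [Real.sqrt_mul hp.le, Real.sqrt_mul hp.le, Real.sqrt_mul hq.le]
  have sp : 0 < Real.sqrt (nn p) := Real.sqrt_pos.2 hp
  have sq : 0 < Real.sqrt (nn q) := Real.sqrt_pos.2 hq
  have sr : 0 < Real.sqrt (nn r) := Real.sqrt_pos.2 hr
  have e : nn q = Real.sqrt (nn q) * Real.sqrt (nn q) := (Real.mul_self_sqrt hq.le).symm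
  rw [div_add_div _ _ (by positivity) (by positivity), div_le_div_iff₀ (by positivity) (by positivity)]
  rw [e] at h1
  simp only [Real.sqrt_mul_self sq.le] at h1
  have h2 := mul_le_mul_of_nonneg_right h1 (by positivity : 0 ≤ Real.sqrt (nn p) * Real.sqrt (nn r))
  nlinarith [h2]

theorem mD_ne {w p : Option ℂ} (h : chordal p w < 1) : mD w p ≠ 0 := by
  intro h0
  have hl := lagrange w p
  rw [h0] at hl
  have hw := nn_pos w
  have hp := nn_pos p
  rw [chordal_eq, div_lt_one (by positivity)] at h
  have := Real.sq_sqrt (mul_pos hp hw).le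
  have h3 : ‖wdg p w‖ ^ 2 < (Real.sqrt (nn p * nn w)) ^ 2 := by
    have := norm_nonneg (wdg p w)
    gcongr
  rw [this] at h3
  simp at hl
  linarith

theorem chordal_le_mob_sub {w p q : Option ℂ} (hp : mD w p ≠ 0) (hq : mD w q ≠ 0) :
    chordal p q ≤ ‖mob w p - mob w q‖ := by
  have hid : mob w p - mob w q = wdg p q * (nn w : ℂ) / (mD w p * mD w q) := by
    rw [mob, mob, div_sub_div _ _ hp hq, nn_cast]
    congr 1
    simp only [wdg, mD]; ring
  have hw := nn_pos w
  have hp' := nn_pos p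
  have hq' := nn_pos q
  rw [hid, chordal_eq, norm_div, norm_mul, norm_mul, Complex.norm_real, Real.norm_of_nonneg hw.le]
  have hpp : 0 < ‖mD w p‖ := norm_pos_iff.2 hp
  have hqq : 0 < ‖mD w q‖ := norm_pos_iff.2 hq
  rw [div_le_div_iff₀ (by positivity) (by positivity)]
  have h1 : ‖mD w p‖ * ‖mD w q‖ ≤ nn w * Real.sqrt (nn p * nn q) := by
    calc ‖mD w p‖ * ‖mD w q‖ ≤ Real.sqrt (nn w * nn p) * Real.sqrt (nn w * nn q) := by
          gcongr <;> exact mD_le _ _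
      _ = nn w * Real.sqrt (nn p * nn q) := by
          rw [← Real.sqrt_mul (by positivity), show nn w * nn p * (nn w * nn q) = (nn w) ^ 2 * (nn p * nn q) by ring,
            Real.sqrt_mul (by positivity), Real.sqrt_sq hw.le]
  calc ‖wdg p q‖ * (‖mD w p‖ * ‖mD w q‖) ≤ ‖wdg p q‖ * (nn w * Real.sqrt (nn p * nn q)) := by gcongr
    _ = _ := by ring

theorem mob_self (w : Option ℂ) : mob w w = 0 := by
  have : wdg w w = 0 := by simp only [wdg]; ring
  simp [mob, this]

theorem mD_self (w : Option ℂ) : mD w w ≠ 0 := by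
  have := nn_cast w
  have hw := nn_pos w
  rw [mD, ← this]
  exact_mod_cast hw.ne'

theorem chordal_le_mob {w p : Option ℂ} (hp : mD w p ≠ 0) : chordal p w ≤ ‖mob w p‖ := by
  have := chordal_le_mob_sub hp (mD_self w)
  rwa [mob_self, sub_zero] at this

theorem mob_le {w p : Option ℂ} (h : chordal p w ≤ 1 / 2) : ‖mob w p‖ ≤ 5 / 4 * chordal p w := by
  have hw := nn_pos w
  have hp := nn_pos p
  have hD := mD_ne (h.trans_lt (by norm_num))
  have hDp : 0 < ‖mD w p‖ := norm_pos_iff.2 hD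
  have hl := lagrange w p
  have hs := Real.sq_sqrt (mul_pos hp hw).le
  have hsp : 0 < Real.sqrt (nn p * nn w) := by positivity
  rw [chordal_eq] at h ⊢
  rw [div_le_iff₀ hsp] at h
  set s := Real.sqrt (nn p * nn w)
  have h4 : 4 / 5 * s ≤ ‖mD w p‖ := by
    apply le_of_sq_le_sq _ hDp.le
    nlinarith [norm_nonneg (wdg p w)]
  have e : 5 / 4 * (‖wdg p w‖ / s) * ‖mD w p‖ = (5 / 4 * ‖wdg p w‖ * ‖mD w p‖) / s := by ring
  rw [mob, norm_div, div_le_iff₀ hDp, e, le_div_iff₀ hsp]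
  nlinarith [norm_nonneg (wdg p w)]

theorem mob_surj (w : Option ℂ) (ζ : ℂ) : ∃ p, mD w p ≠ 0 ∧ mob w p = ζ := by
  have hw : (nn w : ℂ) ≠ 0 := by exact_mod_cast (nn_pos w).ne'
  set u := hU w + ζ * (starRingEnd ℂ) (hV w) with hu
  set v := hV w - ζ * (starRingEnd ℂ) (hU w) with hv
  have hN : u * hV w - v * hU w = ζ * nn w := by rw [nn_cast, hu, hv]; ring
  have hD : (starRingEnd ℂ) (hU w) * u + (starRingEnd ℂ) (hV w) * v = nn w := by rw [nn_cast, hu, hv]; ring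
  by_cases hv0 : v = 0
  · have hu0 : u ≠ 0 := by
      intro h; rw [h, hv0] at hD; simp at hD; exact hw (by exact_mod_cast hD.symm)
    rw [hv0] at hN hD
    simp only [zero_mul, sub_zero, mul_zero, add_zero] at hN hD
    have hD' : mD w none = nn w / u := by
      simp only [mD, hU_none, hV_none, hU_some, hV_some]; rw [eq_div_iff hu0]; simpa using hD
    have hN' : wdg none w = ζ * nn w / u := by
      simp only [wdg, hU_none, hV_none, hU_some, hV_some]; rw [eq_div_iff hu0]; linear_combination hN
    refine ⟨none, ?_, ?_⟩
    · rw [hD']; exact div_ne_zero hw hu0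
    · rw [mob, hD', hN']; field_simp
  · have hD' : mD w (some (u/v)) = nn w / v := by
      simp only [mD, hU_none, hV_none, hU_some, hV_some]; rw [eq_div_iff hv0]; rw [← hD]; field_simp
    have hN' : wdg (some (u/v)) w = ζ * nn w / v := by
      simp only [wdg, hU_none, hV_none, hU_some, hV_some]; rw [eq_div_iff hv0]; rw [← hN]; field_simp
    refine ⟨some (u/v), ?_, ?_⟩
    · rw [hD']; exact div_ne_zero hw hv0
    · rw [mob, hD', hN']; field_simp

theorem mero_eventually_notMem {f : ℂ → ℂ} {P : Set ℂ} (hf : MeroPlane f P) (z : ℂ) :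
    ∀ᶠ y in 𝓝[≠] z, y ∉ P := by
  have hfin := hf.1 (Metric.closedBall z 1) (isCompact_closedBall z 1)
  have hfin2 : ((P ∩ Metric.closedBall z 1) \ {z}).Finite := hfin.subset sdiff_subset
  have h1 : ((P ∩ Metric.closedBall z 1) \ {z})ᶜ ∈ 𝓝 z :=
    hfin2.isClosed.isOpen_compl.mem_nhds (by simp)
  have h2 : Metric.closedBall z 1 ∈ 𝓝 z := Metric.closedBall_mem_nhds z one_pos
  filter_upwards [mem_nhdsWithin_of_mem_nhds h1, mem_nhdsWithin_of_mem_nhds h2, self_mem_nhdsWithin]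
    with y hy1 hy2 hy3 hyP
  exact hy1 ⟨⟨hyP, hy2⟩, hy3⟩

theorem mero_eventually_notMem' {f : ℂ → ℂ} {P : Set ℂ} (hf : MeroPlane f P) {z : ℂ} (hz : z ∉ P) :
    ∀ᶠ y in 𝓝 z, y ∉ P := by
  have := mero_eventually_notMem hf z
  rw [eventually_nhdsWithin_iff] at this
  filter_upwards [this] with y hy
  by_cases h : y = z
  · rwa [h]
  · exact hy h

theorem mero_countable {f : ℂ → ℂ} {P : Set ℂ} (hf : MeroPlane f P) : P.Countable := by
  have : P = ⋃ n : ℕ, P ∩ Metric.closedBall 0 n := by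
    ext z
    simp only [mem_iUnion, mem_inter_iff, Metric.mem_closedBall, dist_zero_right, exists_and_left]
    refine ⟨fun h => ⟨h, exists_nat_ge _⟩, fun h => h.1⟩
  rw [this]
  exact countable_iUnion fun n => (hf.1 _ (isCompact_closedBall 0 _)).countable

theorem transc_not_const {f : ℂ → ℂ} {P : Set ℂ} (hf : TranscMeroPlane f P) {z : ℂ} (hz : z ∉ P)
    (c : ℂ) : ¬ ∀ᶠ y in 𝓝 z, f y = c := by
  intro h
  apply hf.2
  refine ⟨Polynomial.C c, 1, one_ne_zero, ?_⟩
  intro y hy _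
  have hpre : IsPreconnected (Pᶜ) :=
    ((mero_countable hf.1).isPathConnected_compl_of_one_lt_rank
      (by rw [Complex.rank_real_complex]; norm_num)).isConnected.isPreconnected
  have han : AnalyticOnNhd ℂ f Pᶜ := fun x hx => hf.1.2.1 x hx
  have := han.eqOn_of_preconnected_of_eventuallyEq analyticOnNhd_const hpre hz h hy
  simpa using this

theorem transc_deriv_not_zero {f : ℂ → ℂ} {P : Set ℂ} (hf : TranscMeroPlane f P) {z : ℂ} (hz : z ∉ P) :
    ¬ ∀ᶠ y in 𝓝 z, deriv f y = 0 := by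
  intro h
  have h2 := h.and ((hf.1.2.1 z hz).eventually_analyticAt)
  obtain ⟨ε, hε, hb⟩ := Metric.eventually_nhds_iff_ball.1 h2
  apply transc_not_const hf hz (f z)
  filter_upwards [Metric.ball_mem_nhds z hε] with y hy
  exact Metric.isOpen_ball.is_const_of_deriv_eq_zero (convex_ball _ _).isPreconnected
    (fun x hx => (hb x hx).2.differentiableAt.differentiableWithinAt)
    (fun x hx => (hb x hx).1) hy (Metric.mem_ball_self hε)

theorem local_rep {f : ℂ → ℂ} {P : Set ℂ} (hf : TranscMeroPlane f P) (z₁ : ℂ) :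
    ∃ u v : ℂ → ℂ, AnalyticAt ℂ u z₁ ∧ AnalyticAt ℂ v z₁ ∧
      (∀ᶠ z in 𝓝 z₁, ∃ c : ℂ, c ≠ 0 ∧ u z = c * hU (valueAt f P z) ∧ v z = c * hV (valueAt f P z)) ∧
      (deriv u z₁ * v z₁ - u z₁ * deriv v z₁ = 0 → MultiplePoint f z₁) := by
  by_cases hz : z₁ ∈ P
  · have hev : ∀ᶠ z in 𝓝[≠] z₁, z ∉ P ∧ f z ≠ 0 := by
      have h1 := mero_eventually_notMem hf.1 z₁
      have h2 := (hf.1.2.2 z₁ hz).eventually_gt_atTop 0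
      rw [eventually_nhdsWithin_iff] at h1 h2 ⊢
      filter_upwards [h1, h2] with z a b hzz
      exact ⟨a hzz, norm_pos_iff.1 (b (a hzz))⟩
    set g : ℂ → ℂ := Function.update (fun z => (f z)⁻¹) z₁ 0 with hg
    have hg0 : g z₁ = 0 := by simp [hg]
    have hgne : ∀ z, z ≠ z₁ → g z = (f z)⁻¹ := fun z h => by simp [hg, h]
    have hgan : AnalyticAt ℂ g z₁ := by
      refine Complex.analyticAt_of_differentiable_on_punctured_nhds_of_continuousAt ?_ ?_
      · filter_upwards [hev, self_mem_nhdsWithin] with z h1 h2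
        have h3 : DifferentiableAt ℂ (fun z => (f z)⁻¹) z :=
          (hf.1.2.1 z h1.1).differentiableAt.fun_inv h1.2
        refine h3.congr_of_eventuallyEq ?_
        filter_upwards [isOpen_compl_singleton.mem_nhds h2] with y hy using hgne y hy
      · rw [continuousAt_iff_punctured_nhds, hg0]
        have h1 : Tendsto (fun z => ‖f z‖) (𝓝[≠] z₁) atTop := by
          refine (hf.1.2.2 z₁ hz).mono_left ?_
          rw [nhdsWithin, nhdsWithin, le_inf_iff]
          refine ⟨inf_le_left, ?_⟩
          rw [le_principal_iff]
          exact mero_eventually_notMem hf.1 z₁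
        have h2 : Tendsto (fun z => ‖f z‖⁻¹) (𝓝[≠] z₁) (𝓝 0) := tendsto_inv_atTop_zero.comp h1
        rw [tendsto_zero_iff_norm_tendsto_zero]
        refine h2.congr' ?_
        filter_upwards [self_mem_nhdsWithin] with z hzz
        rw [hgne z hzz, norm_inv]
    refine ⟨fun _ => 1, g, analyticAt_const, hgan, ?_, ?_⟩
    · rw [eventually_nhdsWithin_iff] at hev
      filter_upwards [hev] with z hzz
      by_cases h : z = z₁
      · subst h
        refine ⟨1, one_ne_zero, ?_, ?_⟩ <;> simp [valueAt, hz, hU, hV, hg0]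
      · obtain ⟨h1, h2⟩ := hzz h
        refine ⟨(f z)⁻¹, inv_ne_zero h2, ?_, ?_⟩
        · simp [valueAt, h1, hU, h2]
        · simp [valueAt, h1, hV, hgne z h]
    · intro hW
      have hd : deriv g z₁ = 0 := by simpa using hW
      have hnz : ¬ ∀ᶠ z in 𝓝 z₁, g z = 0 := by
        intro h
        obtain ⟨z, ⟨h1, h2⟩, h3⟩ := ((hev.and (h.filter_mono nhdsWithin_le_nhds)).and
          (self_mem_nhdsWithin : {z₁}ᶜ ∈ 𝓝[≠] z₁)).exists
        rw [hgne z h3] at h2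
        exact inv_ne_zero h1.2 h2
      obtain ⟨n, k, hk, hk0, hkn⟩ := (hgan.exists_eventuallyEq_pow_smul_nonzero_iff).2 hnz
      have hn2 : 2 ≤ n := by
        by_contra hlt
        have : n = 0 ∨ n = 1 := by omega
        rcases this with h | h
        · subst h
          have := hkn.self_of_nhds
          rw [hg0] at this
          simp at this
          exact hk0 this.symm
        · subst h
          have e : g =ᶠ[𝓝 z₁] fun z => (z - z₁) * k z := by
            filter_upwards [hkn] with z hz; simpa using hz
          have h1 : HasDerivAt (fun z => (z - z₁) * k z) (1 * k z₁ + (z₁ - z₁) * deriv k z₁) z₁ :=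
            ((hasDerivAt_id z₁).sub_const z₁).mul hk.differentiableAt.hasDerivAt
          rw [e.deriv_eq, h1.deriv] at hd
          simp at hd
          exact hk0 hd
      refine ⟨n, hn2, Or.inl ⟨by omega, fun z => (k z)⁻¹, hk.fun_inv hk0, inv_ne_zero hk0, ?_⟩⟩
      filter_upwards [hkn.filter_mono nhdsWithin_le_nhds, self_mem_nhdsWithin] with z h1 h2
      rw [hgne z h2, smul_eq_mul] at h1
      rw [← inv_inv (f z), h1, mul_inv, div_eq_mul_inv, mul_comm]
  · have hfa := hf.1.2.1 z₁ hz
    refine ⟨f, fun _ => 1, hfa, analyticAt_const, ?_, ?_⟩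
    · filter_upwards [mero_eventually_notMem' hf.1 hz] with z hzz
      refine ⟨1, one_ne_zero, ?_, ?_⟩ <;> simp [valueAt, hzz, hU, hV]
    · intro hW
      have hd : deriv f z₁ = 0 := by simpa using hW
      obtain ⟨n, k, hk, hk0, hkn⟩ :=
        (hfa.deriv.exists_eventuallyEq_pow_smul_nonzero_iff).2 (transc_deriv_not_zero hf hz)
      have hn : 0 < n := by
        rcases Nat.eq_zero_or_pos n with h | h
        · subst h
          have := hkn.self_of_nhds
          rw [hd] at this
          simp at this
          exact absurd this.symm hk0
        · exact h
      refine ⟨n + 1, by omega, Or.inr ⟨hfa, by simpa using hn, k, hk, hk0, ?_⟩⟩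
      filter_upwards [hkn] with z h1
      simpa using h1

theorem rep_ne {f : ℂ → ℂ} {P : Set ℂ} {z u v c : ℂ} (hc : c ≠ 0)
    (hu : u = c * hU (valueAt f P z)) (hv : v = c * hV (valueAt f P z)) : 0 < ‖u‖ ^ 2 + ‖v‖ ^ 2 := by
  have := nn_pos (valueAt f P z)
  rw [nn] at this
  rw [hu, hv, norm_mul, norm_mul]
  have hc' : 0 < ‖c‖ := norm_pos_iff.2 hc
  have : 0 < ‖c‖ ^ 2 * (‖hU (valueAt f P z)‖ ^ 2 + ‖hV (valueAt f P z)‖ ^ 2) := by positivity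
  nlinarith

theorem chordal_continuous {f : ℂ → ℂ} {P : Set ℂ} (hf : TranscMeroPlane f P) (w : Option ℂ) :
    Continuous fun z => chordal (valueAt f P z) w := by
  rw [continuous_iff_continuousAt]
  intro z₁
  obtain ⟨u, v, hu, hv, hrep, -⟩ := local_rep hf z₁
  have e : (fun z => chordal (valueAt f P z) w) =ᶠ[𝓝 z₁]
      fun z => ‖u z * hV w - v z * hU w‖ / Real.sqrt ((‖u z‖ ^ 2 + ‖v z‖ ^ 2) * nn w) := by
    filter_upwards [hrep] with z ⟨c, hc, h1, h2⟩
    have hc' : 0 < ‖c‖ := norm_pos_iff.2 hc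
    rw [chordal_eq, h1, h2]
    have e1 : c * hU (valueAt f P z) * hV w - c * hV (valueAt f P z) * hU w = c * wdg (valueAt f P z) w := by
      rw [wdg]; ring
    have e2 : (‖c * hU (valueAt f P z)‖ ^ 2 + ‖c * hV (valueAt f P z)‖ ^ 2) * nn w =
        ‖c‖ ^ 2 * (nn (valueAt f P z) * nn w) := by
      simp only [nn, norm_mul]; ring
    rw [e1, e2, norm_mul, Real.sqrt_mul (sq_nonneg ‖c‖) (nn (valueAt f P z) * nn w), Real.sqrt_sq hc'.le,
      mul_div_mul_left _ _ hc'.ne']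
  refine ContinuousAt.congr ?_ e.symm
  have hu' := hu.continuousAt
  have hv' := hv.continuousAt
  refine ContinuousAt.div (by fun_prop) (by fun_prop) ?_
  obtain ⟨c, hc, h1, h2⟩ := hrep.self_of_nhds
  have := rep_ne hc h1 h2
  have := nn_pos w
  positivity

theorem mob_analytic {f : ℂ → ℂ} {P : Set ℂ} (hf : TranscMeroPlane f P) (w : Option ℂ) {z₁ : ℂ}
    (hD : mD w (valueAt f P z₁) ≠ 0) :
    AnalyticAt ℂ (fun z => mob w (valueAt f P z)) z₁ ∧
    (deriv (fun z => mob w (valueAt f P z)) z₁ = 0 → MultiplePoint f z₁) := by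
  obtain ⟨u, v, hu, hv, hrep, hcrit⟩ := local_rep hf z₁
  have e : (fun z => mob w (valueAt f P z)) =ᶠ[𝓝 z₁]
      fun z => (u z * hV w - v z * hU w) /
        ((starRingEnd ℂ) (hU w) * u z + (starRingEnd ℂ) (hV w) * v z) := by
    filter_upwards [hrep] with z ⟨c, hc, h1, h2⟩
    have e1 : c * hU (valueAt f P z) * hV w - c * hV (valueAt f P z) * hU w = c * wdg (valueAt f P z) w := by
      rw [wdg]; ring
    have e2 : (starRingEnd ℂ) (hU w) * (c * hU (valueAt f P z)) +
        (starRingEnd ℂ) (hV w) * (c * hV (valueAt f P z)) = c * mD w (valueAt f P z) := by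
      rw [mD]; ring
    rw [h1, h2, e1, e2, mul_div_mul_left _ _ hc, mob]
  have hden : (starRingEnd ℂ) (hU w) * u z₁ + (starRingEnd ℂ) (hV w) * v z₁ ≠ 0 := by
    obtain ⟨c, hc, h1, h2⟩ := hrep.self_of_nhds
    have e2 : (starRingEnd ℂ) (hU w) * (c * hU (valueAt f P z₁)) +
        (starRingEnd ℂ) (hV w) * (c * hV (valueAt f P z₁)) = c * mD w (valueAt f P z₁) := by
      rw [mD]; ring
    rw [h1, h2, e2]
    exact mul_ne_zero hc hD
  constructor
  · refine AnalyticAt.congr ?_ e.symm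
    exact AnalyticAt.fun_div (by fun_prop) (by fun_prop) hden
  · intro h0
    apply hcrit
    have hu' := hu.differentiableAt.hasDerivAt
    have hv' := hv.differentiableAt.hasDerivAt
    have hN := (hu'.mul_const (hV w)).sub (hv'.mul_const (hU w))
    have hDD := (hu'.const_mul ((starRingEnd ℂ) (hU w))).add (hv'.const_mul ((starRingEnd ℂ) (hV w)))
    have hq := hN.div hDD hden
    have hq' := (hq.congr_of_eventuallyEq (by exact e)).deriv
    rw [h0] at hq'
    have h1 := hq'.symm
    rw [div_eq_zero_iff] at h1
    rcases h1 with h1 | h1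
    · have hw : (nn w : ℂ) ≠ 0 := by exact_mod_cast (nn_pos w).ne'
      have : (nn w : ℂ) * (deriv u z₁ * v z₁ - u z₁ * deriv v z₁) = 0 := by
        rw [nn_cast, ← h1]; simp only [Pi.add_apply, Pi.sub_apply]; ring
      exact (mul_eq_zero.1 this).resolve_left hw
    · exact absurd (pow_eq_zero_iff (two_ne_zero) |>.1 h1) hden

/-- isolated values -/
theorem exists_circle {f : ℂ → ℂ} {P : Set ℂ} (hf : TranscMeroPlane f P) :
    ∃ r : ℝ, 0 < r ∧ ∃ ε : ℝ, 0 < ε ∧ ∀ z : ℂ, ‖z‖ = r →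
      ε ≤ chordal (valueAt f P z) (valueAt f P 0) := by
  set w := valueAt f P 0 with hw
  obtain ⟨han, -⟩ := mob_analytic hf w (z₁ := 0) (mD_self w)
  have hc := (chordal_continuous hf w)
  have hev1 : ∀ᶠ z in 𝓝 (0:ℂ), chordal (valueAt f P z) w < 1 := by
    refine hc.continuousAt.eventually_lt continuousAt_const ?_
    rw [← hw, chordal_eq_zero.2 rfl]; norm_num
  have hne : ∀ᶠ z in 𝓝[≠] (0:ℂ), valueAt f P z ≠ w := by
    rcases han.eventually_eq_zero_or_eventually_ne_zero with h | h
    · exfalso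
      have heq : ∀ᶠ z in 𝓝 (0:ℂ), valueAt f P z = w := by
        filter_upwards [h, hev1] with z h1 h2
        rw [← chordal_eq_zero]
        have := chordal_le_mob (mD_ne h2)
        rw [h1, norm_zero] at this
        exact le_antisymm this (chordal_nonneg _ _)
      by_cases h0 : (0:ℂ) ∈ P
      · obtain ⟨z, h1, h2⟩ := ((heq.filter_mono nhdsWithin_le_nhds).and (mero_eventually_notMem hf.1 0)).exists
        simp [hw, valueAt, h0, h2] at h1
      · apply transc_not_const hf h0 (f 0)
        filter_upwards [heq, mero_eventually_notMem' hf.1 h0] with z h1 h2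
        simpa [hw, valueAt, h0, h2] using h1
    · filter_upwards [h] with z hz hzw
      rw [hzw, mob_self] at hz
      exact hz rfl
  rw [eventually_nhdsWithin_iff] at hne
  obtain ⟨r, hr, hb⟩ := Metric.eventually_nhds_iff_ball.1 hne
  have hr2 : 0 < r / 2 := by linarith
  obtain ⟨z₂, hz₂, hmin⟩ := (isCompact_sphere (0:ℂ) (r/2)).exists_isMinOn
    (NormedSpace.sphere_nonempty.2 hr2.le) hc.continuousOn
  have hz2n : ‖z₂‖ = r / 2 := by simpa using hz₂
  refine ⟨r/2, hr2, chordal (valueAt f P z₂) w, ?_, ?_⟩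
  · refine lt_of_le_of_ne (chordal_nonneg _ _) (fun h => ?_)
    refine hb z₂ ?_ ?_ (chordal_eq_zero.1 h.symm)
    · simp [hz2n]; linarith
    · intro h
      have h' : z₂ = 0 := h
      rw [h', norm_zero] at hz2n; linarith
  · intro z hz
    exact hmin (by simpa using hz)

theorem no_lift_escape {f : ℂ → ℂ} {P : Set ℂ}
    {w₀ : Option ℂ} {s : ℝ}
    (hsing : ∀ w, SingularValue f P w → s ≤ chordal w w₀)
    {ζ : ℂ} (hζ : ‖ζ‖ < s) {T : ℝ} (hT0 : 0 < T) (hT1 : T ≤ 1) {γ : ℝ → ℂ}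
    (hc : ContinuousOn γ (Ico 0 T))
    (hlt : ∀ t ∈ Ico 0 T, chordal (valueAt f P (γ t)) w₀ < 1)
    (hF : ∀ t ∈ Ico 0 T, mob w₀ (valueAt f P (γ t)) = t * ζ) :
    ¬ Tendsto (fun t => ‖γ t‖) (𝓝[<] T) atTop := by
  intro hinf
  obtain ⟨ws, hD, hws⟩ := mob_surj w₀ (T * ζ)
  have hnear : chordal ws w₀ < s := by
    refine (chordal_le_mob hD).trans_lt ?_
    rw [hws, norm_mul, Complex.norm_real, Real.norm_eq_abs, abs_of_pos hT0]
    nlinarith [norm_nonneg ζ]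
  refine absurd (hsing ws (Or.inr ?_)) (not_le.2 hnear)
  set τ : ℝ → ℝ := fun x => T - T / (1 + x) with hτ
  have hmem : ∀ x, 0 ≤ x → τ x ∈ Ico 0 T := by
    intro x hx
    have h1 : 0 < 1 + x := by linarith
    have h2 : 0 < T / (1 + x) := by positivity
    have h3 : T / (1 + x) ≤ T := div_le_self hT0.le (by linarith)
    simp only [hτ, mem_Ico]
    constructor <;> linarith
  have hτt : Tendsto τ atTop (𝓝 T) := by
    have : Tendsto (fun x : ℝ => T / (1 + x)) atTop (𝓝 0) :=
      Tendsto.const_div_atTop (tendsto_atTop_add_const_left _ _ tendsto_id) T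
    simpa [hτ] using this.const_sub T
  have hτw : Tendsto τ atTop (𝓝[<] T) := by
    rw [tendsto_nhdsWithin_iff]
    refine ⟨hτt, ?_⟩
    filter_upwards [eventually_ge_atTop 0] with x hx
    exact (hmem x hx).2
  refine ⟨γ ∘ τ, ?_, hinf.comp hτw, ?_⟩
  · refine hc.comp ?_ (fun x hx => hmem x hx)
    refine ContinuousOn.sub continuousOn_const (ContinuousOn.div continuousOn_const (by fun_prop) ?_)
    intro x hx
    have : (0:ℝ) ≤ x := hx
    positivity
  · have hlim : Tendsto (fun x => ‖(τ x : ℂ) * ζ - T * ζ‖) atTop (𝓝 0) := by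
      have h1 : Tendsto (fun x => (τ x : ℂ)) atTop (𝓝 (T:ℂ)) :=
        (Complex.continuous_ofReal.tendsto T).comp hτt
      have h2 := ((h1.mul_const ζ).sub_const ((T:ℂ) * ζ)).norm
      simpa using h2
    refine squeeze_zero' (Eventually.of_forall fun x => chordal_nonneg _ _) ?_ hlim
    filter_upwards [eventually_ge_atTop 0] with x hx
    have := chordal_le_mob_sub (mD_ne (hlt _ (hmem x hx))) hD
    rwa [hF _ (hmem x hx), hws] at this

theorem branch_exists {f : ℂ → ℂ} {P : Set ℂ} (hf : TranscMeroPlane f P)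
    {z₀ : ℂ} {w₀ : Option ℂ} (hw₀ : valueAt f P z₀ = w₀) {s : ℝ} (hs0 : 0 < s) (hs1 : s ≤ 1)
    (hsing : ∀ w, SingularValue f P w → s ≤ chordal w w₀) :
    ∃ φ : Metric.ball (0:ℂ) s → ℂ, IsOpenEmbedding φ ∧
      (∀ w, chordal (valueAt f P (φ w)) w₀ < s ∧ mob w₀ (valueAt f P (φ w)) = w) ∧
      φ ⟨0, Metric.mem_ball_self hs0⟩ = z₀ ∧
      ∀ E : Set ℂ, IsPreconnected E → z₀ ∈ E →
        (∀ z ∈ E, chordal (valueAt f P z) w₀ < 1 ∧ ‖mob w₀ (valueAt f P z)‖ < s) →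
        ∀ z ∈ E, ∃ w, φ w = z := by
  set F : ℂ → ℂ := fun z => mob w₀ (valueAt f P z) with hFdef
  set V : Set ℂ := {z | chordal (valueAt f P z) w₀ < 1 ∧ ‖F z‖ < s} with hV
  have hch := chordal_continuous hf w₀
  have hW : IsOpen {z | chordal (valueAt f P z) w₀ < 1} := isOpen_lt hch continuous_const
  have hFan : ∀ z, chordal (valueAt f P z) w₀ < 1 → AnalyticAt ℂ F z :=
    fun z hz => (mob_analytic hf w₀ (mD_ne hz)).1
  have hVo : IsOpen V := by
    have hco : ContinuousOn F {z | chordal (valueAt f P z) w₀ < 1} :=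
      fun z hz => (hFan z hz).continuousAt.continuousWithinAt
    have := hco.norm.isOpen_inter_preimage hW (isOpen_Iio (a := s))
    exact this
  have hVlt : ∀ z ∈ V, chordal (valueAt f P z) w₀ < s :=
    fun z hz => (chordal_le_mob (mD_ne hz.1)).trans_lt hz.2
  have hder : ∀ z ∈ V, deriv F z ≠ 0 := by
    intro z hz h0
    have hm := (mob_analytic hf w₀ (mD_ne hz.1)).2 h0
    exact absurd (hsing _ (Or.inl ⟨z, hm, rfl⟩)) (not_le.2 (hVlt z hz))
  have hz₀ : z₀ ∈ V := by
    refine ⟨?_, ?_⟩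
    · rw [hw₀, chordal_eq_zero.2 rfl]; norm_num
    · simp only [hFdef]; rw [hw₀, mob_self, norm_zero]; exact hs0
  have hlocF : IsLocalHomeomorphOn F V := by
    refine IsLocalHomeomorphOn.mk F V ?_
    intro z hz
    have hst := ((hFan z hz.1).hasStrictDerivAt).hasStrictFDerivAt_equiv (hder z hz)
    exact ⟨hst.toOpenPartialHomeomorph F, hst.mem_toOpenPartialHomeomorph_source, fun _ _ => rfl⟩
  set p : V → ℂ := fun x => F x with hp
  have hploc : IsLocalHomeomorph p := by
    rw [isLocalHomeomorph_iff_isLocalHomeomorphOn_univ]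
    have h1 : IsLocalHomeomorphOn (Subtype.val : V → ℂ) univ :=
      hVo.isOpenEmbedding_subtypeVal.isLocalHomeomorph.isLocalHomeomorphOn.mono (subset_univ _)
    exact hlocF.comp h1 (fun x _ => x.2)
  have hp0 : p ⟨z₀, hz₀⟩ = 0 := by
    simp only [hp, hFdef]; rw [hw₀, mob_self]
  obtain ⟨φ, hφo, hφp, hφ0⟩ := exists_branch (p := p) (x₀ := ⟨z₀, hz₀⟩) hploc hp0 hs0 (by
    intro ζ hζ
    have hζs : ‖ζ‖ < s := by simpa using hζ
    refine exists_lift_path hploc hp0 ?_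
    intro T hT0 hT1 γ hγc hγ0 hγp
    have hnot := no_lift_escape (f := f) (P := P) (γ := fun t => ((γ t : V) : ℂ)) hsing hζs hT0 hT1
      (continuous_subtype_val.comp_continuousOn hγc) (fun t _ => (γ t).2.1) hγp
    obtain ⟨B, hB⟩ : ∃ B : ℝ, ∃ᶠ t in 𝓝[<] T, ‖((γ t : V) : ℂ)‖ ≤ B := by
      rw [tendsto_atTop] at hnot
      push Not at hnot
      obtain ⟨B, hB⟩ := hnot
      exact ⟨B, hB.mono fun t ht => ht.le⟩
    have hIco : ∀ᶠ t in 𝓝[<] T, t ∈ Ico 0 T := by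
      filter_upwards [Ico_mem_nhdsLT hT0] with t ht using ht
    obtain ⟨z, -, hz⟩ := (isCompact_closedBall (0:ℂ) B).exists_mapClusterPt_of_frequently
      (l := 𝓝[<] T) (f := fun t => ((γ t : V) : ℂ)) (hB.mono fun t ht => by simpa using ht)
    have hnormlt : ∀ t ∈ Ico 0 T, ‖(t:ℂ) * ζ‖ ≤ ‖ζ‖ := by
      intro t ht
      rw [norm_mul, Complex.norm_real, Real.norm_eq_abs, abs_of_nonneg ht.1]
      nlinarith [norm_nonneg ζ, ht.2]
    have hzle : chordal (valueAt f P z) w₀ ≤ ‖ζ‖ := by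
      have hcl : IsClosed {z | chordal (valueAt f P z) w₀ ≤ ‖ζ‖} := isClosed_le hch continuous_const
      refine hcl.mem_of_mapClusterPt hz ?_
      filter_upwards [hIco] with t ht
      refine (chordal_le_mob (mD_ne (γ t).2.1)).trans ?_
      have := hγp t ht
      simp only [hp, hFdef] at this
      rw [this]
      exact hnormlt t ht
    have hz1 : chordal (valueAt f P z) w₀ < 1 := by linarith
    have hFz : ‖F z‖ ≤ ‖ζ‖ := by
      have h1 : MapClusterPt ‖F z‖ (𝓝[<] T) (fun t => ‖F (γ t)‖) :=
        hz.continuousAt_comp (f := fun z => ‖F z‖) (hFan z hz1).continuousAt.norm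
      refine isClosed_Iic.mem_of_mapClusterPt h1 ?_
      filter_upwards [hIco] with t ht
      have := hγp t ht
      simp only [hp] at this
      rw [this]
      exact hnormlt t ht
    have hzV : z ∈ V := ⟨hz1, hFz.trans_lt hζs⟩
    refine ⟨⟨z, hzV⟩, ?_⟩
    rw [mapClusterPt_iff_frequently] at hz ⊢
    intro N hN
    have hN' : Subtype.val '' N ∈ 𝓝 z :=
      hVo.isOpenEmbedding_subtypeVal.isOpenMap.image_mem_nhds hN
    refine (hz _ hN').mono ?_
    rintro t ⟨x, hx, hxt⟩
    rwa [← Subtype.ext hxt])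
  refine ⟨fun w => (φ w : ℂ), hVo.isOpenEmbedding_subtypeVal.comp hφo, ?_, ?_, ?_⟩
  · intro w
    exact ⟨hVlt _ (φ w).2, hφp w⟩
  · show ((φ ⟨0, _⟩ : V) : ℂ) = z₀
    rw [hφ0]
  · intro E hE hz₀E hEV z hz
    have hmem : ∀ x : E, (x:ℂ) ∈ V := fun x => hEV x x.2
    have : PreconnectedSpace E := Subtype.preconnectedSpace hE
    set g₁ : E → V := fun x => ⟨x, hmem x⟩ with hg₁
    have hg₁c : Continuous g₁ := Continuous.subtype_mk continuous_subtype_val _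
    set g₂ : E → V := fun x => φ ⟨p (g₁ x), by simpa using (hmem x).2⟩ with hg₂
    have hg₂c : Continuous g₂ :=
      hφo.continuous.comp (Continuous.subtype_mk (hploc.continuous.comp hg₁c) _)
    have heq : g₁ = g₂ := by
      refine IsSeparatedMap.eq_of_comp_eq (p := p) (T2Space.isSeparatedMap p) hploc.isLocallyInjective
        hg₁c hg₂c ?_ ⟨z₀, hz₀E⟩ ?_
      · funext x
        simp only [Function.comp, hg₂]
        rw [hφp]
      · have h1 : g₁ ⟨z₀, hz₀E⟩ = ⟨z₀, hz₀⟩ := rfl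
        refine (h1.trans hφ0.symm).trans ?_
        exact congrArg φ (Subtype.ext hp0.symm)
    refine ⟨⟨p (g₁ ⟨z, hz⟩), by simpa using (hmem ⟨z, hz⟩).2⟩, ?_⟩
    have := congrArg Subtype.val (congrFun heq ⟨z, hz⟩)
    exact this.symm
/-- Lemma 5.1: for `f` in the Speiser class with singular values among
`a₁, …, a_κ`, any connected set `E` far from the origin on which `χ(f, α) < ρ²` either lies
in a component of `{χ(f, a_j) < 2ρ}`, or lies in a simply connected subdomain of `ℂ \ {0}`
and has logarithmic diameter at most `400πρ`. -/
theorem speiser_component_dichotomy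
    (f : ℂ → ℂ) (Pf : Set ℂ)
    (hf : TranscMeroPlane f Pf)
    (κ : ℕ) (a : Fin κ → Option ℂ)
    (hsing : ∀ w : Option ℂ, SingularValue f Pf w → ∃ j, w = a j) :
    ∃ R : ℝ, 0 < R ∧ ∃ ρ₀ : ℝ, 0 < ρ₀ ∧
      ∀ ρ : ℝ, 0 < ρ → ρ < ρ₀ → ∀ α : Option ℂ, ∀ E : Set ℂ,
        E.Nonempty → IsPreconnected E →
        E ⊆ {z : ℂ | R < ‖z‖} →
        (∀ z ∈ E, chordal (valueAt f Pf z) α < ρ ^ 2) →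
        ((∃ j, ∃ C : Set ℂ,
            IsComponentOf C {z : ℂ | chordal (valueAt f Pf z) (a j) < 2 * ρ} ∧ E ⊆ C) ∨
         (∃ U : Set ℂ, IsOpen U ∧ IsPreconnected U ∧ (0 : ℂ) ∉ U ∧
            SimplyConnectedSpace U ∧ E ⊆ U ∧
            ∀ u ∈ E, ∀ v ∈ E, ‖Complex.log (u / v)‖ ≤ 400 * Real.pi * ρ)) := by
  obtain ⟨r, hr, ε, hε, hcirc⟩ := exists_circle hf
  refine ⟨r, hr, min (1 / 1000) (ε / 2), lt_min (by norm_num) (by linarith), ?_⟩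
  intro ρ hρ0 hρlt α E hEne hEc hER hEα
  have hρ1 : ρ < 1 / 1000 := hρlt.trans_le (min_le_left _ _)
  have hρε : ρ < ε / 2 := hρlt.trans_le (min_le_right _ _)
  obtain ⟨z₀, hz₀⟩ := hEne
  have hρsq : ρ ^ 2 < ρ / 1000 := by nlinarith
  by_cases hcase : ∃ j, chordal α (a j) < ρ
  · left
    obtain ⟨j, hj⟩ := hcase
    have hsub : E ⊆ {z : ℂ | chordal (valueAt f Pf z) (a j) < 2 * ρ} := by
      intro z hz
      have h1 := chordal_triangle (valueAt f Pf z) α (a j)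
      have h2 := hEα z hz
      simp only [mem_ofPred_eq]
      linarith
    exact ⟨j, _, ⟨z₀, hsub hz₀, rfl⟩, hEc.subset_connectedComponentIn hz₀ hsub⟩
  right
  push Not at hcase
  set w₀ := valueAt f Pf z₀ with hw₀
  set s : ℝ := ρ - ρ ^ 2 with hs
  have hs0 : 0 < s := by linarith
  have hsρ : s < ρ := by have := pow_pos hρ0 2; linarith
  have hs1 : s ≤ 1 := by linarith
  have hw₀α : chordal w₀ α < ρ ^ 2 := hEα z₀ hz₀
  have hsing' : ∀ w, SingularValue f Pf w → s ≤ chordal w w₀ := by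
    intro w hw
    obtain ⟨j, rfl⟩ := hsing w hw
    have h1 := hcase j
    have h2 := chordal_triangle α w₀ (a j)
    rw [chordal_comm α w₀, chordal_comm w₀ (a j)] at h2
    linarith
  obtain ⟨φ, hφo, hφ, hφ0, hφE⟩ := branch_exists hf hw₀.symm hs0 hs1 hsing'
  have hEch : ∀ z ∈ E, chordal (valueAt f Pf z) w₀ < 2 * ρ ^ 2 := by
    intro z hz
    have h1 := chordal_triangle (valueAt f Pf z) α w₀
    rw [chordal_comm α w₀] at h1
    have := hEα z hz
    linarith
  have hEmob : ∀ z ∈ E, ‖mob w₀ (valueAt f Pf z)‖ < 5 / 2 * ρ ^ 2 := by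
    intro z hz
    have h1 := hEch z hz
    have h2 := mob_le (w := w₀) (p := valueAt f Pf z) (by linarith)
    linarith
  have hEU := hφE E hEc hz₀ (fun z hz => ⟨by have := hEch z hz; linarith,
    by have := hEmob z hz; linarith⟩)
  have : ContractibleSpace (Metric.ball (0:ℂ) s) :=
    (convex_ball (0:ℂ) s).contractibleSpace ⟨0, Metric.mem_ball_self hs0⟩
  have hpre : IsPreconnected (range φ) := by
    have : PreconnectedSpace (Metric.ball (0:ℂ) s) :=
      Subtype.preconnectedSpace (convex_ball (0:ℂ) s).isPreconnected
    exact isPreconnected_range hφo.continuous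
  have hz₀U : z₀ ∈ range φ := ⟨_, hφ0⟩
  have h0U : (0:ℂ) ∉ range φ := by
    rintro ⟨w, hw⟩
    have hiv := hpre.intermediate_value (a := 0) (b := z₀) ⟨w, hw⟩ hz₀U
      (f := fun z : ℂ => ‖z‖) continuous_norm.continuousOn
    have hrm : r ∈ Icc ‖(0:ℂ)‖ ‖z₀‖ := ⟨by simpa using hr.le, le_of_lt (hER hz₀)⟩
    obtain ⟨z, ⟨w', hw'⟩, hz⟩ := hiv hrm
    have h1 := hcirc z hz
    have h2 := (hφ w).1
    have h3 := (hφ w').1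
    rw [hw] at h2
    rw [hw'] at h3
    have h4 := chordal_triangle (valueAt f Pf z) w₀ (valueAt f Pf 0)
    rw [chordal_comm w₀] at h4
    linarith
  refine ⟨range φ, hφo.isOpen_range, hpre, h0U, ?_, fun z hz => hEU z hz, ?_⟩
  · exact (hφo.isEmbedding.toHomeomorph.symm.toHomotopyEquiv).simplyConnectedSpace
  · intro u hu v hv
    classical
    set ψ : ℂ → ℂ := fun ζ => if h : ζ ∈ Metric.ball (0:ℂ) s then φ ⟨ζ, h⟩ else 0 with hψ
    have hψv : ∀ ζ (h : ζ ∈ Metric.ball (0:ℂ) s), ψ ζ = φ ⟨ζ, h⟩ := by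
      intro ζ h
      simp only [hψ]
      rw [dif_pos h]
    have hψc : ContinuousOn ψ (Metric.ball (0:ℂ) s) := by
      rw [continuousOn_iff_continuous_domRestrict]
      have : (Metric.ball (0:ℂ) s).domRestrict ψ = φ := by
        funext x
        exact hψv x x.2
      rw [this]
      exact hφo.continuous
    have hFψ : ∀ ζ ∈ Metric.ball (0:ℂ) s, mob w₀ (valueAt f Pf (ψ ζ)) = ζ := by
      intro ζ h
      rw [hψv ζ h]
      exact (hφ ⟨ζ, h⟩).2
    have hψd : DifferentiableOn ℂ ψ (Metric.ball (0:ℂ) s) := by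
      intro ζ h
      have hnb : Metric.ball (0:ℂ) s ∈ 𝓝 ζ := Metric.isOpen_ball.mem_nhds h
      have hlt : chordal (valueAt f Pf (ψ ζ)) w₀ < s := by
        rw [hψv ζ h]; exact (hφ ⟨ζ, h⟩).1
      obtain ⟨han, hcr⟩ := mob_analytic hf w₀ (z₁ := ψ ζ) (mD_ne (by linarith))
      have hne : deriv (fun z => mob w₀ (valueAt f Pf z)) (ψ ζ) ≠ 0 := by
        intro h0
        exact absurd (hsing' _ (Or.inl ⟨_, hcr h0, rfl⟩)) (not_le.2 hlt)
      have hd := HasDerivAt.of_local_left_inverse (hψc.continuousAt hnb)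
        han.differentiableAt.hasDerivAt hne
        (by filter_upwards [hnb] with y hy using hFψ y hy)
      exact hd.differentiableAt.differentiableWithinAt
    have hψi : InjOn ψ (Metric.ball (0:ℂ) s) := by
      intro x hx y hy hxy
      rw [← hFψ x hx, ← hFψ y hy, hxy]
    have hψ0 : ∀ z ∈ Metric.ball (0:ℂ) s, ψ z ≠ 0 := by
      intro z hz h
      rw [hψv z hz] at h
      exact h0U ⟨_, h⟩
    have hback : ∀ z ∈ E, ψ (mob w₀ (valueAt f Pf z)) = z := by
      intro z hz
      obtain ⟨w, hw⟩ := hEU z hz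
      have h1 := (hφ w).2
      rw [hw] at h1
      rw [h1, hψv _ w.2]
      exact hw
    have hts : 5 / 2 * ρ ^ 2 < s := by linarith
    have hbd : 48 * Real.pi / (s - 5 / 2 * ρ ^ 2) * (2 * (5 / 2 * ρ ^ 2)) ≤ 400 * Real.pi * ρ := by
      have hpos : 0 < s - 5 / 2 * ρ ^ 2 := by linarith
      rw [div_mul_eq_mul_div, div_le_iff₀ hpos]
      have h1 : 240 * ρ ^ 2 ≤ 400 * ρ * (s - 5 / 2 * ρ ^ 2) := by
        have : 3 / 5 * ρ ≤ s - 5 / 2 * ρ ^ 2 := by linarith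
        nlinarith
      nlinarith [Real.pi_pos]
    have hfin := log_bound hs0 hts hψd hψi hψ0 (by nlinarith [Real.pi_pos])
      (u := mob w₀ (valueAt f Pf u)) (v := mob w₀ (valueAt f Pf v))
      (by simpa using hEmob u hu) (by simpa using hEmob v hv)
    rw [hback u hu, hback v hv] at hfin
    exact hfin.trans hbd

end
end

section
/- Let f be a transcendental meromorphic function in the plane such that all singular values of f⁻¹ lie in a finite set {a₁, …, a_κ} of finite complex numbers, with |a_j − a_{j'}| ≥ 2σ > 0 whenever a_j ≠ a_{j'}, and suppose that all zeros of f' have multiplicity at most M − 1, for some fixed positive integer M. Then there exists ρ₀ > 0 (small compared with σ) such that for each 0 < ρ < ρ₀ there exists R(ρ) > 0 with the following property: if |z₀| > R(ρ), |f(z₀) − a_j| < ρ for some j, and a_j ∈ f(F), where F is the component of {z ∈ ℂ : |f(z) − a_j| < σ} containing z₀, then z₀ lies in a simply connected component D ⊆ ℂ \ {0} of the set {z ∈ ℂ : |f(z) − a_j| < ρ}, and D has logarithmic diameter at most 16π(ρ/σ)^{1/M}. -/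
open Filter Set Topology Bornology MeasureTheory

noncomputable section

lemma si_id1 (e w : ℂ) : ‖1 - (starRingEnd ℂ) e * w‖^2 - ‖w - e‖^2 = (1 - ‖e‖^2) * (1 - ‖w‖^2) := by
  simp only [← Complex.normSq_eq_norm_sq, Complex.normSq_apply]
  simp; ring

lemma si_id2 (r : ℝ) (c z : ℂ) : ‖(r:ℂ)^2 - (starRingEnd ℂ) c * z‖^2 - r^2 * ‖z - c‖^2
    = (r^2 - ‖c‖^2) * (r^2 - ‖z‖^2) := by
  simp only [← Complex.normSq_eq_norm_sq, Complex.normSq_apply]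
  simp [pow_two]; ring

lemma si_locmax (q : ℂ → ℂ) (c : ℂ) (r : ℝ) (hr : 0 < r) (hq : AnalyticAt ℂ q c)
    (hq1 : ‖q c‖ < 1) (hc : ‖c‖ < r)
    (hmax : ∀ᶠ z in 𝓝 c, ‖deriv q z‖ * (r^2 - ‖z‖^2) / (1 - ‖q z‖^2) ≤
      ‖deriv q c‖ * (r^2 - ‖c‖^2) / (1 - ‖q c‖^2)) :
    ‖deriv q c‖ * (r^2 - ‖c‖^2) ≤ r * (1 - ‖q c‖^2) := by
  by_contra hcon
  push Not at hcon
  set e := q c with he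
  set α : ℂ → ℂ := fun z => 1 - (starRingEnd ℂ) e * q z with hα
  set β : ℂ → ℂ := fun z => (r:ℂ)^2 - (starRingEnd ℂ) c * z with hβ
  have hE : 0 < 1 - ‖e‖^2 := by nlinarith [norm_nonneg e]
  have hC : 0 < r^2 - ‖c‖^2 := by nlinarith [norm_nonneg c]
  have hαa : AnalyticAt ℂ α c := by fun_prop
  have hβa : AnalyticAt ℂ β c := by fun_prop
  have hαc : α c = ((1 - ‖e‖^2 : ℝ) : ℂ) := by
    simp only [hα, ← he]; rw [mul_comm, Complex.mul_conj, Complex.normSq_eq_norm_sq]; push_cast; ring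
  have hβc : β c = ((r^2 - ‖c‖^2 : ℝ) : ℂ) := by
    simp only [hβ]; rw [mul_comm, Complex.mul_conj, Complex.normSq_eq_norm_sq]; push_cast; ring
  have hnα : ‖α c‖ = 1 - ‖e‖^2 := by rw [hαc, Complex.norm_real, Real.norm_of_nonneg hE.le]
  have hnβ : ‖β c‖ = r^2 - ‖c‖^2 := by rw [hβc, Complex.norm_real, Real.norm_of_nonneg hC.le]
  have hα0 : α c ≠ 0 := by rw [← norm_pos_iff, hnα]; exact hE
  have hβ0 : β c ≠ 0 := by rw [← norm_pos_iff, hnβ]; exact hC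
  set p : ℂ → ℂ := fun z => deriv q z * β z ^ 2 / α z ^ 2 with hp
  have hpa : AnalyticAt ℂ p c := by
    apply AnalyticAt.div (hq.deriv.mul (hβa.pow 2)) (hαa.pow 2) (pow_ne_zero _ hα0)
  have hpc : ‖p c‖ = ‖deriv q c‖ * (r^2 - ‖c‖^2)^2 / (1 - ‖e‖^2)^2 := by
    simp only [hp, norm_div, norm_mul, norm_pow, hnα, hnβ]
  have hd0 : 0 < ‖deriv q c‖ := by
    by_contra h
    have : ‖deriv q c‖ = 0 := le_antisymm (not_lt.mp h) (norm_nonneg _)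
    rw [this] at hcon; nlinarith
  -- eventual strict inequality
  have hev : ∀ᶠ z in 𝓝[≠] c, r * ‖α z‖ < ‖slope q c z‖ * ‖β z‖ := by
    have h1 : Tendsto (fun z => r * ‖α z‖) (𝓝[≠] c) (𝓝 (r * ‖α c‖)) :=
      ((hαa.continuousAt.norm.const_mul r).tendsto).mono_left nhdsWithin_le_nhds
    have h2 : Tendsto (fun z => ‖slope q c z‖ * ‖β z‖) (𝓝[≠] c) (𝓝 (‖deriv q c‖ * ‖β c‖)) :=
      ((hasDerivAt_iff_tendsto_slope.mp hq.differentiableAt.hasDerivAt).norm).mul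
        ((hβa.continuousAt.norm.tendsto).mono_left nhdsWithin_le_nhds)
    refine h1.eventually_lt h2 ?_
    rw [hnα, hnβ]; exact hcon
  have hα0' : ∀ᶠ z in 𝓝 c, α z ≠ 0 := hαa.continuousAt.eventually_ne hα0
  have hq1' : ∀ᶠ z in 𝓝 c, ‖q z‖ < 1 := hq.continuousAt.norm.eventually_lt continuousAt_const hq1
  -- key inequality
  have key : ∀ᶠ z in 𝓝[≠] c, deriv q z ≠ 0 → ‖p z‖ < ‖p c‖ := by
    filter_upwards [hev, hα0'.filter_mono nhdsWithin_le_nhds, hq1'.filter_mono nhdsWithin_le_nhds,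
      hmax.filter_mono nhdsWithin_le_nhds, self_mem_nhdsWithin] with z h1 h2 h3 h4 h5 h6
    have hzc : 0 < ‖z - c‖ := norm_pos_iff.mpr (sub_ne_zero.mpr h5)
    have hs : ‖slope q c z‖ * ‖z - c‖ = ‖q z - e‖ := by
      rw [slope_def_field, norm_div, ← he]; field_simp
    have h7 : r * ‖z - c‖ * ‖α z‖ < ‖q z - e‖ * ‖β z‖ := by rw [← hs]; nlinarith
    have i1 := si_id1 e (q z)
    have i2 := si_id2 r c z
    have hd : 0 < ‖deriv q z‖ := norm_pos_iff.mpr h6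
    have hQ : 0 < 1 - ‖q z‖^2 := by nlinarith [norm_nonneg (q z)]
    have hαp : 0 < ‖α z‖ := norm_pos_iff.mpr h2
    rw [hpc]
    simp only [hp, norm_div, norm_mul, norm_pow]
    rw [div_le_div_iff₀ hQ hE] at h4
    rw [div_lt_div_iff₀ (by positivity) (by positivity)]
    change ‖α z‖^2 - _ = _ at i1
    change ‖β z‖^2 - _ = _ at i2
    have h8 : (r * ‖z - c‖ * ‖α z‖)^2 < (‖q z - e‖ * ‖β z‖)^2 := by
      apply pow_lt_pow_left₀ h7 (by positivity) (by norm_num)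
    set A := ‖α z‖; set B := ‖β z‖; set X := ‖q z - e‖; set Y := ‖z - c‖
    set Q := 1 - ‖q z‖^2; set Z := r^2 - ‖z‖^2
    set E1 := 1 - ‖e‖^2; set C1 := r^2 - ‖c‖^2
    set d := ‖deriv q z‖; set d0 := ‖deriv q c‖
    -- A^2 - X^2 = E1 Q, B^2 - r²Y² = C1 Z ; d Z E1 ≤ d0 C1 Q
    have h9 : B^2 * (E1 * Q) < A^2 * (C1 * Z) := by rw [← i1, ← i2]; nlinarith
    have h10 : d * B^2 * (E1 * Q) < A^2 * C1 * (d0 * C1 * Q / E1) := by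
      calc d * B^2 * (E1 * Q) = d * (B^2 * (E1 * Q)) := by ring
        _ < d * (A^2 * (C1 * Z)) := by gcongr
        _ = A^2 * C1 * (d * Z * E1 / E1) := by field_simp
        _ ≤ _ := by gcongr
    have h11 : d * B^2 * E1 < A^2 * C1 * (d0 * C1 / E1) := by
      refine lt_of_mul_lt_mul_right (a := Q) ?_ hQ.le
      calc _ = d * B^2 * (E1 * Q) := by ring
        _ < _ := h10
        _ = _ := by ring
    calc d * B^2 * E1^2 = (d * B^2 * E1) * E1 := by ring
      _ < (A^2 * C1 * (d0 * C1 / E1)) * E1 := by gcongr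
      _ = _ := by field_simp
  have hpmax : IsLocalMax (norm ∘ p) c := by
    have : ∀ᶠ z in 𝓝[≠] c, ‖p z‖ ≤ ‖p c‖ := by
      filter_upwards [key] with z hz
      by_cases h : deriv q z = 0
      · simp [hp, h]; positivity
      · exact (hz h).le
    rw [eventually_nhdsWithin_iff] at this
    filter_upwards [this] with z hz
    by_cases h : z = c
    · simp [h]
    · exact hz h
  have hconst := Complex.eventually_eq_of_isLocalMax_norm
    (hpa.eventually_analyticAt.mono fun _ h => h.differentiableAt) hpmax
  have hpc0 : 0 < ‖p c‖ := by rw [hpc]; positivity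
  obtain ⟨z, h1, h2⟩ := (key.and (hconst.filter_mono nhdsWithin_le_nhds)).exists
  have : deriv q z ≠ 0 := by
    intro h
    have : p z = 0 := by simp [hp, h]
    rw [h2] at this; rw [this] at hpc0; simp at hpc0
  have := h1 this
  rw [h2] at this
  exact lt_irrefl _ this

lemma si_umono {s t : ℝ} (hs : 0 ≤ s) (hst : s ≤ t) (ht : t ≤ 10/3) :
    √s * (10 - s) ≤ √t * (10 - t) := by
  have h10s : 0 ≤ 10 - s := by linarith
  have h10t : 0 ≤ 10 - t := by linarith
  apply le_of_sq_le_sq _ (by positivity)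
  rw [mul_pow, mul_pow, Real.sq_sqrt hs, Real.sq_sqrt (hs.trans hst)]
  have h : 0 ≤ (t - s) * ((10/3 - t)^2 + (10/3-t)*(10/3-s) + (10/3-s)^2 + 10*((10/3-t)+(10/3-s))) := by
    have h1 : 0 ≤ t - s := by linarith
    have h2 : 0 ≤ 10/3 - t := by linarith
    have h3 : 0 ≤ 10/3 - s := by linarith
    positivity
  nlinarith [h]

lemma si_ubound {d : ℝ} (hd : 0 ≤ d) (ht : d ≤ 10/3) : √d * (10 - d) ≤ 4 * √10 := by
  have h10 : 0 ≤ 10 - d := by linarith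
  apply le_of_sq_le_sq _ (by positivity)
  rw [mul_pow, mul_pow, Real.sq_sqrt hd, Real.sq_sqrt (by norm_num)]
  have : 0 ≤ (10/3 - d)^2 * (40/3 - d) := mul_nonneg (sq_nonneg _) (by linarith)
  nlinarith

lemma si_locmax2 (g : ℂ → ℂ) (b c : ℂ) (hg : AnalyticAt ℂ g c) (hb : g c ≠ b)
    (hlt : ‖g c - b‖ < 10) (hc : ‖c‖ < 1/2)
    (hmax : ∀ᶠ z in 𝓝 c, ‖deriv g z‖ * ((1/2)^2 - ‖z‖^2) / (√‖g z - b‖ * (10 - ‖g z - b‖)) ≤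
      ‖deriv g c‖ * ((1/2)^2 - ‖c‖^2) / (√‖g c - b‖ * (10 - ‖g c - b‖))) :
    ‖deriv g c‖ * ((1/2)^2 - ‖c‖^2) / (√‖g c - b‖ * (10 - ‖g c - b‖)) ≤ 1 / √10 := by
  set s0 := g c - b with hs0
  have hs00 : s0 ≠ 0 := sub_ne_zero.mpr hb
  obtain ⟨κ, hκ⟩ : ∃ κ : ℂ, κ^2 = s0 / 10 := IsAlgClosed.exists_pow_nat_eq _ (by norm_num)
  set q : ℂ → ℂ := fun z => κ * Complex.exp (Complex.log ((g z - b)/s0) / 2) with hq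
  have hd1 : AnalyticAt ℂ (fun z => (g z - b)/s0) c := by fun_prop
  have hone : (fun z => (g z - b)/s0) c = 1 := by simp only [← hs0]; field_simp
  have hqa : AnalyticAt ℂ q c := by
    have : AnalyticAt ℂ (fun z => Complex.log ((g z - b)/s0)) c :=
      hd1.clog (by have := hone; dsimp only at this; rw [this]; exact Complex.one_mem_slitPlane)
    fun_prop
  have hne : ∀ᶠ z in 𝓝 c, g z - b ≠ 0 :=
    (hg.continuousAt.sub continuousAt_const).eventually_ne hs00
  have hsq : ∀ᶠ z in 𝓝 c, q z ^ 2 = (g z - b) / 10 := by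
    filter_upwards [hne] with z hz
    simp only [hq, mul_pow, hκ, ← Complex.exp_nat_mul]
    rw [show ((2:ℕ):ℂ) * (Complex.log ((g z - b)/s0) / 2) = Complex.log ((g z - b)/s0) by push_cast; ring,
      Complex.exp_log (div_ne_zero hz hs00)]
    field_simp
  have hder : ∀ᶠ z in 𝓝 c, 2 * q z * deriv q z = deriv g z / 10 := by
    filter_upwards [hsq.eventually_nhds, hqa.eventually_analyticAt, hg.eventually_analyticAt]
      with z h1 h2 h3
    have e1 : deriv (fun z => q z ^2) z = deriv (fun z => (g z - b)/10) z := Filter.EventuallyEq.deriv_eq h1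
    rw [deriv_fun_pow h2.differentiableAt] at e1
    rw [deriv_div_const, deriv_sub_const] at e1
    simpa using e1
  have hlt' : ∀ᶠ z in 𝓝 c, ‖g z - b‖ < 10 :=
    (hg.continuousAt.sub continuousAt_const).norm.eventually_lt continuousAt_const hlt
  have hconv : ∀ᶠ z in 𝓝 c, ‖deriv q z‖ * ((1/2)^2 - ‖z‖^2) / (1 - ‖q z‖^2) =
      (√10/2) * (‖deriv g z‖ * ((1/2)^2 - ‖z‖^2) / (√‖g z - b‖ * (10 - ‖g z - b‖))) ∧ ‖q z‖ < 1 := by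
    filter_upwards [hsq, hder, hne, hlt'] with z h1 h2 h3 h4
    have n1 : ‖q z‖^2 = ‖g z - b‖/10 := by
      rw [← norm_pow, h1, norm_div]; simp
    have n2 : 2 * ‖q z‖ * ‖deriv q z‖ = ‖deriv g z‖ / 10 := by
      have := congrArg norm h2
      simpa using this
    have n3 : ‖q z‖ = √‖g z - b‖ / √10 := by
      rw [← Real.sqrt_div (norm_nonneg _), ← n1, Real.sqrt_sq (norm_nonneg _)]
    have pos : 0 < √‖g z - b‖ := Real.sqrt_pos.mpr (norm_pos_iff.mpr h3)
    have pos10 : 0 < √(10:ℝ) := by positivity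
    have s10 : √(10:ℝ)*√10 = 10 := Real.mul_self_sqrt (by norm_num)
    constructor
    · rw [n1]
      have n4 : ‖deriv q z‖ = ‖deriv g z‖ * √10 / (20 * √‖g z - b‖) := by
        rw [n3] at n2
        field_simp at n2 ⊢
        linarith
      rw [n4]
      have : 10 - ‖g z - b‖ ≠ 0 := by linarith
      have : 1 - ‖g z - b‖/10 ≠ 0 := by intro h; apply this; linarith
      field_simp
      ring
    · nlinarith [norm_nonneg (q z)]
  have hcc := hconv.self_of_nhds
  have := si_locmax q c (1/2) (by norm_num) hqa hcc.2 hc (by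
    filter_upwards [hconv, hmax] with z h1 h2
    rw [h1.1, hcc.1]
    gcongr)
  have hpos : 0 < 1 - ‖q c‖^2 := by nlinarith [norm_nonneg (q c), hcc.2]
  rw [← div_le_iff₀ hpos, hcc.1] at this
  have pos10 : 0 < √(10:ℝ) := by positivity
  rw [le_div_iff₀ pos10]
  linarith

lemma si_bloch (g : ℂ → ℂ) (hg : DifferentiableOn ℂ g (Metric.ball 0 1))
    (hinj : InjOn g (Metric.ball 0 1))
    (hper : ∀ z ∈ Metric.ball (0:ℂ) 1, ∀ w ∈ Metric.ball (0:ℂ) 1,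
      g z ≠ g w + 2 * Real.pi * Complex.I) : ‖deriv g 0‖ ≤ 16 := by
  set U := Metric.ball (0:ℂ) 1 with hU
  have hUo : IsOpen U := Metric.isOpen_ball
  have h0U : (0:ℂ) ∈ U := by simp [hU]
  have hga : AnalyticOnNhd ℂ g U := hg.analyticOnNhd hUo
  set Ω := g '' U with hΩ
  have hΩo : IsOpen Ω := by
    rcases hga.is_constant_or_isOpen (convex_ball (0:ℂ) 1).isPreconnected with ⟨w, hw⟩ | h
    · exfalso
      have h2 : (1/2:ℂ) ∈ U := by simp [hU]; norm_num
      have := hinj h0U h2 ((hw 0 h0U).trans (hw _ h2).symm)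
      norm_num at this
    · exact h U le_rfl hUo
  have hΩc : IsClosed Ωᶜ := hΩo.isClosed_compl
  have hΩne : (Ωᶜ).Nonempty := by
    refine ⟨g 0 + 2 * Real.pi * Complex.I, ?_⟩
    rintro ⟨z, hz, h⟩
    exact hper z hz 0 h0U h
  set d : ℂ → ℝ := fun z => Metric.infDist (g z) Ωᶜ with hd
  have hdpos : ∀ z ∈ U, 0 < d z := by
    intro z hz
    rw [hd]
    refine (hΩc.notMem_iff_infDist_pos hΩne).mp ?_
    simp only [mem_compl_iff, not_not]; exact mem_image_of_mem g hz
  have hdpi : ∀ z ∈ U, d z ≤ Real.pi := by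
    intro z hz
    by_contra hcon
    push Not at hcon
    have hsub : ∀ y, dist (g z) y < d z → y ∈ Ω := by
      intro y hy
      by_contra h
      exact absurd (Metric.infDist_le_dist_of_mem (x := g z) (s := Ωᶜ) h) (not_le.mpr hy)
    have hnpi : ‖(Real.pi:ℂ) * Complex.I‖ = Real.pi := by simp [abs_of_pos Real.pi_pos]
    obtain ⟨z1, hz1, e1⟩ := hsub (g z + Real.pi * Complex.I) (by rw [dist_eq_norm]; simpa [abs_of_pos Real.pi_pos] using hcon)
    obtain ⟨z2, hz2, e2⟩ := hsub (g z - Real.pi * Complex.I) (by rw [dist_eq_norm]; simpa [abs_of_pos Real.pi_pos] using hcon)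
    apply hper z1 hz1 z2 hz2
    rw [e1, e2]; ring
  have hpi : Real.pi < 10/3 := by linarith [Real.pi_lt_d2]
  have hd3 : ∀ z ∈ U, d z < 10/3 := fun z hz => (hdpi z hz).trans_lt hpi
  set K := Metric.closedBall (0:ℂ) (1/2) with hK
  have hKU : K ⊆ U := Metric.closedBall_subset_ball (by norm_num)
  set u : ℝ → ℝ := fun t => √t * (10 - t) with hu
  have hupos : ∀ z ∈ U, 0 < u (d z) := by
    intro z hz
    have := hdpos z hz; have := hd3 z hz
    exact mul_pos (Real.sqrt_pos.mpr (hdpos z hz)) (by linarith)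
  set Φ : ℂ → ℝ := fun z => ‖deriv g z‖ * ((1/2)^2 - ‖z‖^2) / u (d z) with hΦ
  have hdc : ContinuousOn d K := (Metric.continuous_infDist_pt _).comp_continuousOn (hg.continuousOn.mono hKU)
  have hΦc : ContinuousOn Φ K := by
    have h1 : ContinuousOn (deriv g) K := (hga.deriv.continuousOn).mono hKU
    refine ContinuousOn.div (h1.norm.mul (by fun_prop)) ?_ (fun z hz => (hupos z (hKU hz)).ne')
    exact (Real.continuous_sqrt.comp_continuousOn hdc).mul (continuousOn_const.sub hdc)
  by_cases hg0 : deriv g 0 = 0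
  · simp [hg0]
  obtain ⟨c, hcK, hcmax⟩ := (isCompact_closedBall (0:ℂ) (1/2)).exists_isMaxOn
    ⟨0, by simp⟩ hΦc
  have h0K : (0:ℂ) ∈ K := by simp [hK]
  have hΦ0 : 0 < Φ 0 := by
    simp only [hΦ]
    apply div_pos _ (hupos 0 h0U)
    apply mul_pos (norm_pos_iff.mpr hg0); norm_num
  have hΦ0c : Φ 0 ≤ Φ c := hcmax h0K
  have hcU := hKU hcK
  have hc2 : ‖c‖ < 1/2 := by
    rcases lt_or_eq_of_le (mem_closedBall_zero_iff.mp hcK) with h | h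
    · exact h
    · exfalso
      have : Φ c = 0 := by simp [hΦ, h]
      linarith
  obtain ⟨b, hbΩ, hbd⟩ := hΩc.exists_infDist_eq_dist hΩne (g c)
  have hbd' : d c = ‖g c - b‖ := by rw [← dist_eq_norm, ← hbd]
  have hgcb : g c ≠ b := by
    intro h
    have := hdpos c hcU
    rw [hbd', h] at this; simp at this
  have hΨ : ∀ᶠ z in 𝓝 c, ‖deriv g z‖ * ((1/2)^2 - ‖z‖^2) / (u ‖g z - b‖) ≤ Φ z := by
    have e1 : ∀ᶠ z in 𝓝 c, ‖g z - b‖ < 10/3 := by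
      apply ((hga c hcU).continuousAt.sub continuousAt_const).norm.eventually_lt continuousAt_const
      have := hd3 c hcU
      rwa [hbd'] at this
    have e2 : ∀ᶠ z in 𝓝 c, z ∈ K := Metric.closedBall_mem_nhds_of_mem (by simpa using hc2)
    filter_upwards [e1, e2] with z h1 h2
    simp only [hΦ]
    have hz2 : ‖z‖ ≤ 1/2 := mem_closedBall_zero_iff.mp h2
    have hnn : 0 ≤ (1/2)^2 - ‖z‖^2 := by nlinarith [norm_nonneg z]
    have := hupos z (hKU h2)
    apply div_le_div_of_nonneg_left (by positivity) this
    apply si_umono (hdpos z (hKU h2)).le _ h1.le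
    rw [← dist_eq_norm]
    exact Metric.infDist_le_dist_of_mem hbΩ
  have hfin := si_locmax2 g b c (hga c hcU) hgcb (by rw [← hbd']; linarith [hd3 c hcU]) hc2 (by
    have e2 : ∀ᶠ z in 𝓝 c, z ∈ K := Metric.closedBall_mem_nhds_of_mem (by simpa using hc2)
    filter_upwards [hΨ, e2] with z h1 h2
    refine h1.trans ((hcmax h2).trans ?_)
    simp only [hΦ, hbd', hu]; exact le_rfl)
  have h3 : Φ 0 ≤ 1 / √10 := by
    refine hΦ0c.trans ?_
    simp only [hΦ, hbd', hu]; exact hfin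
  have pos10 : 0 < √(10:ℝ) := by positivity
  simp only [hΦ] at h3
  rw [div_le_div_iff₀ (hupos 0 h0U) pos10] at h3
  have h4 := si_ubound (hdpos 0 h0U).le (hd3 0 h0U).le
  change u (d 0) ≤ _ at h4
  simp only [norm_zero] at h3
  have h5 : ‖deriv g 0‖ * √10 ≤ 16 * √10 := by linarith
  exact le_of_mul_le_mul_right h5 pos10

lemma si_logdist (h : ℂ → ℂ) (hd : DifferentiableOn ℂ h (Metric.ball 0 1))
    (hinj : InjOn h (Metric.ball 0 1)) (h0 : ∀ z ∈ Metric.ball (0:ℂ) 1, h z ≠ 0)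
    (r : ℝ) (hr : 0 < r) (hr20 : r ≤ 1/20) (w w' : ℂ) (hw : ‖w‖ < r) (hw' : ‖w'‖ < r) :
    ‖Complex.log (h w / h w')‖ ≤ 16 * Real.pi * r := by
  have hUo : IsOpen (Metric.ball (0:ℂ) 1) := Metric.isOpen_ball
  have h0U : (0:ℂ) ∈ Metric.ball (0:ℂ) 1 := by simp
  have hquot : DifferentiableOn ℂ (fun z => deriv h z / h z) (Metric.ball 0 1) :=
    (hd.deriv hUo).div hd h0
  obtain ⟨g, hg0, hg⟩ := (hquot.isExactOn_ball).with_val_at 0 (Complex.log (h 0))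
  have hexp : ∀ z ∈ Metric.ball (0:ℂ) 1, Complex.exp (g z) = h z := by
    have hder : ∀ z ∈ Metric.ball (0:ℂ) 1, HasDerivAt (fun z => h z * Complex.exp (-g z)) 0 z := by
      intro z hz
      have h1 := (hd.differentiableAt (hUo.mem_nhds hz)).hasDerivAt
      have h2 := (hg z hz).neg.cexp
      refine (h1.fun_mul h2).congr_deriv ?_
      have h3 := h0 z hz
      have h4 : h z * (deriv h z / h z) = deriv h z := by field_simp
      linear_combination (-Complex.exp (-g z)) * h4
    intro z hz
    have hc := hUo.is_const_of_deriv_eq_zero (convex_ball (0:ℂ) 1).isPreconnected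
      (fun z hz => (hder z hz).differentiableAt.differentiableWithinAt)
      (fun z hz => (hder z hz).deriv) hz h0U
    simp only [hg0] at hc
    rw [Complex.exp_neg, Complex.exp_neg, Complex.exp_log (h0 0 h0U), mul_inv_cancel₀ (h0 0 h0U)] at hc
    field_simp at hc
    exact hc.symm
  have hbound : ∀ z ∈ Metric.ball (0:ℂ) 1, ‖deriv g z‖ * (1 - ‖z‖) ≤ 16 := by
    intro c hc
    have hc1 : ‖c‖ < 1 := by simpa using hc
    set s : ℝ := 1 - ‖c‖ with hs
    have hspos : 0 < s := by linarith
    have hmap : ∀ z ∈ Metric.ball (0:ℂ) 1, c + s * z ∈ Metric.ball (0:ℂ) 1 := by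
      intro z hz
      have hz1 : ‖z‖ < 1 := by simpa using hz
      rw [mem_ball_zero_iff]
      calc ‖c + s * z‖ ≤ ‖c‖ + s * ‖z‖ := by
            refine (norm_add_le _ _).trans ?_
            simp [abs_of_pos hspos]
        _ < 1 := by nlinarith
    have hga : ∀ z ∈ Metric.ball (0:ℂ) 1, HasDerivAt (fun z => g (c + s * z)) (deriv g (c + s * z) * s) z := by
      intro z hz
      have h1 := (hg _ (hmap z hz)).differentiableAt.hasDerivAt
      have h2 : HasDerivAt (fun z : ℂ => c + s * z) (s:ℂ) z := by
        simpa using ((hasDerivAt_id z).const_mul (s:ℂ)).const_add c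
      exact h1.comp z h2
    have hb := si_bloch (fun z => g (c + s * z))
      (fun z hz => (hga z hz).differentiableAt.differentiableWithinAt)
      (by
        intro x hx y hy hxy
        have : h (c + s * x) = h (c + s * y) := by
          rw [← hexp _ (hmap x hx), ← hexp _ (hmap y hy)]; exact congrArg _ hxy
        have := hinj (hmap x hx) (hmap y hy) this
        have hs0 : (s:ℂ) ≠ 0 := by exact_mod_cast hspos.ne'
        exact mul_left_cancel₀ hs0 (add_left_cancel this))
      (by
        intro x hx y hy hxy
        have h3 : h (c + s * x) = h (c + s * y) := by
          rw [← hexp _ (hmap x hx), ← hexp _ (hmap y hy), hxy, Complex.exp_periodic]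
        have h4 := hinj (hmap x hx) (hmap y hy) h3
        simp only [h4] at hxy
        have : (2:ℂ) * Real.pi * Complex.I = 0 := by linear_combination -hxy
        exact Complex.two_pi_I_ne_zero this)
    rw [(hga 0 h0U).deriv] at hb
    simpa [abs_of_pos hspos] using hb
  have hsub : Metric.ball (0:ℂ) r ⊆ Metric.ball (0:ℂ) 1 := Metric.ball_subset_ball (by linarith)
  have hwr : w ∈ Metric.ball (0:ℂ) r := by simpa using hw
  have hwr' : w' ∈ Metric.ball (0:ℂ) r := by simpa using hw'
  have hmv : ‖g w - g w'‖ ≤ (16 * (20/19)) * ‖w - w'‖ := by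
    apply (convex_ball (0:ℂ) r).norm_image_sub_le_of_norm_deriv_le
      (fun z hz => (hg z (hsub hz)).differentiableAt) _ hwr' hwr
    intro z hz
    have h1 := hbound z (hsub hz)
    have h2 : ‖z‖ < r := by simpa using hz
    nlinarith [norm_nonneg (deriv g z)]
  have hww : ‖w - w'‖ ≤ 2 * r := (norm_sub_le _ _).trans (by linarith)
  have h2 : ‖g w - g w'‖ ≤ 16 * 3 * r := by nlinarith
  have hlog : Complex.log (h w / h w') = g w - g w' := by
    rw [← hexp w (hsub hwr), ← hexp w' (hsub hwr'), ← Complex.exp_sub]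
    have him := (Complex.abs_im_le_norm (g w - g w')).trans h2
    have : |(g w - g w').im| ≤ 16 * 3/20 := by linarith
    have hpi := Real.pi_gt_three
    rw [abs_le] at this
    exact Complex.log_exp (by linarith [this.1]) (by linarith [this.2])
  rw [hlog]
  nlinarith [Real.pi_gt_three]

lemma si_localinv (f : ℂ → ℂ) (P : Set ℂ) (hP : IsClosed P) (hfa : ∀ z ∉ P, AnalyticAt ℂ f z)
    (z : ℂ) (hz : z ∉ P) (hd : deriv f z ≠ 0) :
    ∃ e : OpenPartialHomeomorph ℂ ℂ, z ∈ e.source ∧ e.source ⊆ Pᶜ ∧ ⇑e = f := by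
  have hs := (hfa z hz).hasStrictDerivAt
  have hs' : HasStrictFDerivAt f ((ContinuousLinearEquiv.unitsEquivAut ℂ (Units.mk0 _ hd) : ℂ ≃L[ℂ] ℂ) : ℂ →L[ℂ] ℂ) z :=
    hs.hasStrictFDerivAt_equiv hd
  refine ⟨(hs'.toOpenPartialHomeomorph f).restrOpen Pᶜ hP.isOpen_compl, ?_, ?_, ?_⟩
  · simp only [OpenPartialHomeomorph.restrOpen_source]
    exact ⟨hs'.mem_toOpenPartialHomeomorph_source, hz⟩
  · simp only [OpenPartialHomeomorph.restrOpen_source]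
    exact inter_subset_right
  · rfl

lemma si_uniq (f : ℂ → ℂ) (P : Set ℂ) (hP : IsClosed P) (hfa : ∀ z ∉ P, AnalyticAt ℂ f z)
    {A : Type*} [TopologicalSpace A] {S : Set A} (hS : IsPreconnected S) (g₁ g₂ : A → ℂ)
    (h1 : ContinuousOn g₁ S) (h2 : ContinuousOn g₂ S)
    (hg : ∀ s ∈ S, g₁ s ∉ P ∧ deriv f (g₁ s) ≠ 0) (heq : ∀ s ∈ S, f (g₁ s) = f (g₂ s))
    (s₀ : A) (hs₀ : s₀ ∈ S) (h0 : g₁ s₀ = g₂ s₀) : ∀ s ∈ S, g₁ s = g₂ s := by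
  have := isPreconnected_iff_preconnectedSpace.mp hS
  have c1 : Continuous (fun s : S => g₁ s) := continuousOn_iff_continuous_domRestrict.mp h1
  have c2 : Continuous (fun s : S => g₂ s) := continuousOn_iff_continuous_domRestrict.mp h2
  have hcl : IsClopen {s : S | g₁ s = g₂ s} := by
    refine ⟨isClosed_eq c1 c2, ?_⟩
    rw [isOpen_iff_mem_nhds]
    intro s hs
    obtain ⟨e, he, heP, hef⟩ := si_localinv f P hP hfa _ (hg s s.2).1 (hg s s.2).2
    have o := e.open_source
    have n1 : ∀ᶠ t : S in 𝓝 s, g₁ (t:A) ∈ e.source := (c1.continuousAt (x := s)).eventually (o.mem_nhds he)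
    have n2 : ∀ᶠ t : S in 𝓝 s, g₂ (t:A) ∈ e.source := (c2.continuousAt (x := s)).eventually (o.mem_nhds (by
      show g₂ (s:A) ∈ e.source
      have : g₁ (s:A) = g₂ s := hs
      rwa [← this]))
    filter_upwards [n1, n2] with t t1 t2
    apply e.injOn t1 t2
    rw [hef]; exact heq t t.2
  have := hcl.eq_univ ⟨⟨s₀, hs₀⟩, h0⟩
  intro s hs
  have : (⟨s, hs⟩ : S) ∈ {s : S | g₁ s = g₂ s} := by rw [this]; trivial
  exact this

/-- lift of `H` on `[0,t]` -/
def SiLift (f : ℂ → ℂ) (P : Set ℂ) (H : ℝ → ℂ) (x₀ : ℂ) (t : ℝ) (γ : ℝ → ℂ) : Prop :=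
  ContinuousOn γ (Icc 0 t) ∧ γ 0 = x₀ ∧ ∀ s ∈ Icc 0 t, γ s ∉ P ∧ f (γ s) = H s

lemma si_extend (f : ℂ → ℂ) (P : Set ℂ) (H : ℝ → ℂ) (x₀ : ℂ) (t₁ t₂ : ℝ) (γ : ℝ → ℂ)
    (hH : ContinuousOn H (Icc 0 1)) (h0 : 0 ≤ t₁) (h12 : t₁ ≤ t₂) (h2 : t₂ ≤ 1)
    (hL : SiLift f P H x₀ t₁ γ) (e : OpenPartialHomeomorph ℂ ℂ) (he : γ t₁ ∈ e.source)
    (heP : e.source ⊆ Pᶜ) (hef : ⇑e = f) (hHt : ∀ s ∈ Icc t₁ t₂, H s ∈ e.target) :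
    ∃ γ', SiLift f P H x₀ t₂ γ' := by
  obtain ⟨c, g0, hl⟩ := hL
  have e1 : e.symm (H t₁) = γ t₁ := by
    rw [← (hl t₁ ⟨h0, le_rfl⟩).2, ← hef, e.left_inv he]
  set γ' : ℝ → ℂ := fun s => if s ≤ t₁ then γ s else e.symm (H s) with hγ'
  have q1 : ∀ s ∈ Icc 0 t₁, γ' s = γ s := fun s hs => by simp [hγ', hs.2]
  have q2 : ∀ s ∈ Icc t₁ t₂, γ' s = e.symm (H s) := fun s hs => by
    rcases eq_or_lt_of_le hs.1 with h | h
    · subst h; simp [hγ', e1]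
    · simp [hγ', not_le.mpr h]
  refine ⟨γ', ?_, ?_, ?_⟩
  · rw [← Icc_union_Icc_eq_Icc h0 h12]
    refine ContinuousOn.union_of_isClosed (c.congr q1) ?_ isClosed_Icc isClosed_Icc
    refine ContinuousOn.congr ?_ q2
    exact e.continuousOn_symm.comp (hH.mono (Icc_subset_Icc h0 h2)) hHt
  · rw [q1 0 ⟨le_rfl, h0⟩, g0]
  · intro s hs
    rcases le_total s t₁ with h | h
    · rw [q1 s ⟨hs.1, h⟩]; exact hl s ⟨hs.1, h⟩
    · rw [q2 s ⟨h, hs.2⟩]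
      have := hHt s ⟨h, hs.2⟩
      refine ⟨heP (e.map_target this), ?_⟩
      rw [← hef, e.right_inv this]

lemma si_pathlift (f : ℂ → ℂ) (P : Set ℂ) (hP : IsClosed P) (hfa : ∀ z ∉ P, AnalyticAt ℂ f z)
    (hpole : ∀ p ∈ P, Tendsto (fun z => ‖f z‖) (𝓝[Pᶜ] p) atTop)
    (N : Set ℂ) (hcrit : ∀ z ∉ P, f z ∈ N → deriv f z ≠ 0)
    (hasym : ∀ v ∈ N, ∀ γ : ℝ → ℂ, ContinuousOn γ (Ici 0) → Tendsto (fun t => ‖γ t‖) atTop atTop →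
      (∀ t, 0 ≤ t → γ t ∉ P) → Tendsto (fun t => f (γ t)) atTop (𝓝 v) → False)
    (H : ℝ → ℂ) (hH : ContinuousOn H (Icc 0 1)) (hHN : ∀ t ∈ Icc (0:ℝ) 1, H t ∈ N)
    (x₀ : ℂ) (hx₀ : x₀ ∉ P) (hx₀' : f x₀ = H 0) :
    ∃ γ, SiLift f P H x₀ 1 γ := by
  set S : Set ℝ := {t | t ∈ Icc (0:ℝ) 1 ∧ ∃ γ, SiLift f P H x₀ t γ} with hS
  have h0S : (0:ℝ) ∈ S := by
    refine ⟨by simp, fun _ => x₀, continuousOn_const, rfl, ?_⟩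
    intro s hs
    have : s = 0 := le_antisymm hs.2 hs.1
    subst this; exact ⟨hx₀, hx₀'⟩
  have hbdd : BddAbove S := ⟨1, fun t ht => ht.1.2⟩
  set T := sSup S with hT
  have hT0 : 0 ≤ T := le_csSup hbdd h0S
  have hT1 : T ≤ 1 := csSup_le ⟨0, h0S⟩ fun t ht => ht.1.2
  have hTI : T ∈ Icc (0:ℝ) 1 := ⟨hT0, hT1⟩
  -- main step
  have hmain : ∀ e : OpenPartialHomeomorph ℂ ℂ, e.source ⊆ Pᶜ → ⇑e = f → H T ∈ e.target →
      (∀ δ > 0, ∃ t₁, 0 ≤ t₁ ∧ t₁ ≤ T ∧ T - δ < t₁ ∧ ∃ γ, SiLift f P H x₀ t₁ γ ∧ γ t₁ ∈ e.source) →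
      ∃ γ, SiLift f P H x₀ 1 γ := by
    intro e heP hef htgt hex
    have hn := (hH T hTI) (e.open_target.mem_nhds htgt)
    rw [mem_map, Metric.mem_nhdsWithin_iff] at hn
    obtain ⟨δ, hδ, hsub⟩ := hn
    obtain ⟨t₁, ht0, htT, htδ, γ, hγ, hγs⟩ := hex δ hδ
    have hle : T ≤ min 1 (T + δ/2) := le_min hT1 (by linarith)
    obtain ⟨γ', hγ'⟩ := si_extend f P H x₀ t₁ (min 1 (T + δ/2)) γ hH ht0 (htT.trans hle)
      (min_le_left _ _) hγ e hγs heP hef (by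
        intro s hs
        have hs2 := le_min_iff.mp hs.2
        have : s ∈ Metric.ball T δ ∩ Icc 0 1 := by
          refine ⟨?_, ht0.trans hs.1, hs2.1⟩
          rw [Metric.mem_ball, Real.dist_eq, abs_lt]
          constructor <;> linarith [hs.1, hs2.2]
        exact hsub this)
    have hmem : min 1 (T + δ/2) ∈ S := ⟨⟨hT0.trans hle, min_le_left _ _⟩, γ', hγ'⟩
    have h3 : min 1 (T + δ/2) ≤ T := le_csSup hbdd hmem
    rcases min_choice 1 (T + δ/2) with h | h
    · rw [h] at hγ'; exact ⟨γ', hγ'⟩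
    · rw [h] at h3; linarith
  by_cases hTS : T ∈ S
  · obtain ⟨_, γ, hγ⟩ := hTS
    have hT' := hγ.2.2 T ⟨hT0, le_rfl⟩
    obtain ⟨e, he, heP, hef⟩ := si_localinv f P hP hfa _ hT'.1
      (hcrit _ hT'.1 (by rw [hT'.2]; exact hHN T hTI))
    refine hmain e heP hef ?_ ?_
    · rw [← hT'.2, ← hef]; exact e.map_source he
    · intro δ hδ
      exact ⟨T, hT0, le_rfl, by linarith, γ, hγ, he⟩
  -- limit case
  have hTpos : 0 < T := lt_of_le_of_ne hT0 (fun h => hTS (h ▸ h0S))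
  have hlt : ∀ t, 0 ≤ t → t < T → ∃ γ, SiLift f P H x₀ t γ := by
    intro t ht htT
    obtain ⟨s, hs, hts⟩ := exists_lt_of_lt_csSup ⟨0, h0S⟩ htT
    obtain ⟨_, γ, c, g0, hl⟩ := hs
    exact ⟨γ, c.mono (Icc_subset_Icc le_rfl hts.le), g0, fun s hs => hl s ⟨hs.1, hs.2.trans hts.le⟩⟩
  choose! G hG using hlt
  have hcoh : ∀ t, 0 ≤ t → t < T → ∀ s ∈ Icc 0 t, G s s = G t s := by
    intro t ht htT s hs
    have l1 := hG s hs.1 (hs.2.trans_lt htT)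
    have l2 := hG t ht htT
    refine si_uniq f P hP hfa (isPreconnected_Icc (a := 0) (b := s)) (G s) (G t) l1.1
      (l2.1.mono (Icc_subset_Icc le_rfl hs.2)) ?_ ?_ 0 ⟨le_rfl, hs.1⟩ (l1.2.1.trans l2.2.1.symm) s
      ⟨hs.1, le_rfl⟩
    · intro x hx
      have := l1.2.2 x hx
      refine ⟨this.1, hcrit _ this.1 ?_⟩
      rw [this.2]
      exact hHN x ⟨hx.1, by linarith [hx.2, hs.2]⟩
    · intro x hx
      rw [(l1.2.2 x hx).2, (l2.2.2 x ⟨hx.1, hx.2.trans hs.2⟩).2]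
  set Γ : ℝ → ℂ := fun t => G t t with hΓ
  have hΓp : ∀ t, 0 ≤ t → t < T → Γ t ∉ P ∧ f (Γ t) = H t := fun t h0 h1 =>
    (hG t h0 h1).2.2 t ⟨h0, le_rfl⟩
  have hΓc : ContinuousOn Γ (Ico 0 T) := by
    intro s hs
    obtain ⟨t, hst, htT⟩ := exists_between hs.2
    have h1 : ContinuousOn Γ (Icc 0 t) :=
      (hG t (hs.1.trans hst.le) htT).1.congr fun x hx => hcoh t (hs.1.trans hst.le) htT x hx
    have h2 := h1 s ⟨hs.1, hst.le⟩
    refine h2.mono_of_mem_nhdsWithin ?_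
    have : Iio t ∈ 𝓝 s := Iio_mem_nhds hst
    filter_upwards [mem_nhdsWithin_of_mem_nhds this, self_mem_nhdsWithin] with x hx hx'
    exact ⟨hx'.1, le_of_lt hx⟩
  have hev : ∀ᶠ t in 𝓝[<] T, 0 ≤ t ∧ t < T := by
    filter_upwards [mem_nhdsWithin_of_mem_nhds (Ioi_mem_nhds hTpos), self_mem_nhdsWithin] with x h1 h2
    exact ⟨le_of_lt h1, h2⟩
  have hHlim : Tendsto H (𝓝[<] T) (𝓝 (H T)) := by
    refine (hH T hTI).mono_left ?_
    refine nhdsWithin_le_iff.mpr ?_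
    filter_upwards [hev] with x hx
    exact ⟨hx.1, hx.2.le.trans hT1⟩
  have hfΓ : Tendsto (fun t => f (Γ t)) (𝓝[<] T) (𝓝 (H T)) := by
    refine hHlim.congr' ?_
    filter_upwards [hev] with x hx
    exact (hΓp x hx.1 hx.2).2.symm
  have hnot : ¬ Tendsto (fun t => ‖Γ t‖) (𝓝[<] T) atTop := by
    intro htend
    set φ : ℝ → ℝ := fun x => T - T / (1 + x) with hφ
    have hφm : ∀ x, 0 ≤ x → φ x ∈ Ico 0 T := by
      intro x hx
      have h1 : 0 < 1 + x := by linarith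
      have h2 : 0 < T / (1 + x) := by positivity
      have h3 : T / (1 + x) ≤ T := div_le_self hT0 (by linarith)
      constructor <;> simp only [hφ] <;> linarith
    have hφt : Tendsto φ atTop (𝓝[<] T) := by
      rw [tendsto_nhdsWithin_iff]
      constructor
      · have : Tendsto (fun x : ℝ => T / (1 + x)) atTop (𝓝 0) :=
          (tendsto_const_nhds).div_atTop (tendsto_atTop_add_const_left _ _ tendsto_id)
        simpa using (tendsto_const_nhds (x := T)).sub this
      · filter_upwards [eventually_ge_atTop 0] with x hx
        exact (hφm x hx).2
    have hφc : ContinuousOn φ (Ici 0) := by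
      apply continuousOn_const.sub
      apply ContinuousOn.div continuousOn_const (by fun_prop)
      intro x hx
      have : (0:ℝ) ≤ x := hx
      linarith
    refine hasym (H T) (hHN T hTI) (Γ ∘ φ) (hΓc.comp hφc fun x hx => hφm x hx)
      (htend.comp hφt) ?_ (hfΓ.comp hφt)
    intro t ht
    exact (hΓp _ (hφm t ht).1 (hφm t ht).2).1
  obtain ⟨B, hB⟩ : ∃ B, ∃ᶠ t in 𝓝[<] T, Γ t ∈ Metric.closedBall (0:ℂ) B := by
    rw [tendsto_atTop] at hnot
    push Not at hnot
    obtain ⟨B, hB⟩ := hnot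
    refine ⟨B, hB.mono fun t ht => ?_⟩
    rw [mem_closedBall_zero_iff]; exact ht.le
  obtain ⟨p, _, hp⟩ := (isCompact_closedBall (0:ℂ) B).exists_mapClusterPt_of_frequently hB
  rw [mapClusterPt_iff_frequently] at hp
  have hpP : p ∉ P := by
    intro hpP
    have h1 := (hpole p hpP).eventually_gt_atTop (‖H T‖ + 1)
    rw [eventually_nhdsWithin_iff] at h1
    have h2 : ∀ᶠ t in 𝓝[<] T, ‖f (Γ t)‖ < ‖H T‖ + 1 :=
      hfΓ.norm.eventually_lt_const (by linarith)
    obtain ⟨t, ht1, ht2, ht3⟩ := ((hp _ h1).and_eventually (h2.and hev)).exists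
    exact lt_asymm ht2 (ht1 (hΓp t ht3.1 ht3.2).1)
  have hfp : f p = H T := by
    by_contra hne
    obtain ⟨u, v, hu, hv, huv⟩ := t2_separation_nhds hne
    have h1 := (hfa p hpP).continuousAt hu
    obtain ⟨t, ht1, ht2⟩ := ((hp _ h1).and_eventually (hfΓ hv)).exists
    exact huv.le_bot ⟨ht1, ht2⟩
  obtain ⟨e, he, heP, hef⟩ := si_localinv f P hP hfa p hpP
      (hcrit _ hpP (by rw [hfp]; exact hHN T hTI))
  refine hmain e heP hef ?_ ?_
  · rw [← hfp, ← hef]; exact e.map_source he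
  · intro δ hδ
    have h2 : ∀ᶠ t in 𝓝[<] T, T - δ < t :=
      mem_nhdsWithin_of_mem_nhds (Ioi_mem_nhds (by linarith))
    obtain ⟨t, ht1, ht2, ht3⟩ := ((hp _ (e.open_source.mem_nhds he)).and_eventually (h2.and hev)).exists
    exact ⟨t, ht3.1, ht3.2.le, ht2, G t, hG t ht3.1 ht3.2, ht1⟩

lemma si_liftdiff (f : ℂ → ℂ) (g φ : ℂ → ℂ) (w : ℂ) (hf : AnalyticAt ℂ f (g w))
    (hd : deriv f (g w) ≠ 0) (hg : ContinuousAt g w) (hφ : DifferentiableAt ℂ φ w)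
    (hfg : ∀ᶠ x in 𝓝 w, f (g x) = φ x) : DifferentiableAt ℂ g w := by
  have hs' := hf.hasStrictDerivAt.hasStrictFDerivAt_equiv hd
  set e := hs'.toOpenPartialHomeomorph f with he
  have hef : ⇑e = f := rfl
  have hsrc : g w ∈ e.source := hs'.mem_toOpenPartialHomeomorph_source
  have h0 : φ w = e (g w) := by rw [hef]; exact hfg.self_of_nhds.symm
  have htg : φ w ∈ e.target := by rw [h0]; exact e.map_source hsrc
  have hsy : e.symm (φ w) = g w := by rw [h0, e.left_inv hsrc]
  have h1 : HasDerivAt e.symm (deriv f (g w))⁻¹ (φ w) := by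
    apply e.hasDerivAt_symm htg hd
    rw [hsy, hef]
    exact hf.differentiableAt.hasDerivAt
  have h2 : DifferentiableAt ℂ (fun x => e.symm (φ x)) w := h1.differentiableAt.comp w hφ
  refine h2.congr_of_eventuallyEq ?_
  filter_upwards [hfg, hg.eventually (e.open_source.mem_nhds hsrc)] with x hx hx'
  rw [← hx, ← hef, e.left_inv hx']

lemma si_local (f : ℂ → ℂ) (P : Set ℂ) (hP : IsClosed P) (zc a : ℂ) (σ : ℝ) (hσ : 0 < σ)
    (hf : AnalyticAt ℂ f zc) (hzc : zc ∉ P) (hfz : f zc = a) (hnc : ¬ ∀ᶠ z in 𝓝 zc, f z = a) :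
    ∃ k : ℕ, 1 ≤ k ∧ (∃ G : ℂ → ℂ, AnalyticAt ℂ G zc ∧ G zc ≠ 0 ∧
        ∀ᶠ z in 𝓝 zc, f z = a + (z - zc) ^ k * G z) ∧
      ∃ h : ℂ → ℂ, ∃ ε > 0, ε < 1 ∧ DifferentiableOn ℂ h (Metric.ball 0 ε) ∧
        InjOn h (Metric.ball 0 ε) ∧ h 0 = zc ∧
        ∀ w ∈ Metric.ball (0:ℂ) ε, h w ∉ P ∧ f (h w) = a + σ * w ^ k := by
  have hfa : AnalyticAt ℂ (fun z => f z - a) zc := hf.sub analyticAt_const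
  obtain ⟨k, G, hG, hG0, hfG⟩ := (hfa.exists_eventuallyEq_pow_smul_nonzero_iff).mpr (by
    intro h; apply hnc; filter_upwards [h] with z hz; exact sub_eq_zero.mp hz)
  have hk : 1 ≤ k := by
    by_contra hk
    have hk : k = 0 := by omega
    subst hk
    have := hfG.self_of_nhds
    simp [hfz] at this
    exact hG0 this.symm
  have hk0 : (k:ℂ) ≠ 0 := by exact_mod_cast (by omega : k ≠ 0)
  have hσ' : (σ:ℂ) ≠ 0 := by exact_mod_cast hσ.ne'
  refine ⟨k, hk, ⟨G, hG, hG0, ?_⟩, ?_⟩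
  · filter_upwards [hfG] with z hz
    rw [smul_eq_mul] at hz
    rw [← hz]; ring
  obtain ⟨b, hb⟩ := IsAlgClosed.exists_pow_nat_eq (G zc / σ) (show 0 < k by omega)
  have hb0 : b ≠ 0 := by
    rintro rfl
    rw [zero_pow (by omega)] at hb
    exact div_ne_zero hG0 hσ' hb.symm
  set E : ℂ → ℂ := fun z => b * Complex.exp (Complex.log (G z / G zc) / k) with hE
  have hEa : AnalyticAt ℂ E zc := by
    apply analyticAt_const.mul
    apply AnalyticAt.cexp
    apply AnalyticAt.div _ analyticAt_const hk0
    apply AnalyticAt.clog (hG.div analyticAt_const hG0)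
    show G zc / G zc ∈ _
    rw [div_self hG0]; exact Complex.one_mem_slitPlane
  have hE0 : E zc = b := by simp [hE, div_self hG0]
  set q : ℂ → ℂ := fun z => (z - zc) * E z with hq
  have hqa : AnalyticAt ℂ q zc := (analyticAt_id.sub analyticAt_const).mul hEa
  have hqd : deriv q zc = b := by
    have h1 : HasDerivAt (fun z : ℂ => z - zc) 1 zc := (hasDerivAt_id zc).sub_const zc
    have := h1.mul hEa.differentiableAt.hasDerivAt
    have h2 := this.deriv
    simp at h2
    rw [← hE0, ← h2]; rfl
  have hqk : ∀ᶠ z in 𝓝 zc, f z = a + σ * q z ^ k := by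
    filter_upwards [hfG, hG.continuousAt.eventually_ne hG0] with z hz hz0
    have : E z ^ k = G z / σ := by
      simp only [hE]
      rw [mul_pow, hb, ← Complex.exp_nat_mul, mul_div_cancel₀ _ hk0, Complex.exp_log (div_ne_zero hz0 hG0)]
      field_simp
    simp only [hq]
    rw [mul_pow, this]
    rw [smul_eq_mul] at hz
    have : f z = a + (z - zc)^k * G z := by rw [← hz]; ring
    rw [this]; field_simp
  have hdb : deriv q zc ≠ 0 := by rw [hqd]; exact hb0
  have hs' := hqa.hasStrictDerivAt.hasStrictFDerivAt_equiv hdb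
  set e := hs'.toOpenPartialHomeomorph q with he
  have heq : ⇑e = q := rfl
  have hsrc : zc ∈ e.source := hs'.mem_toOpenPartialHomeomorph_source
  have hq0 : q zc = 0 := by simp [hq]
  have htg : (0:ℂ) ∈ e.target := by rw [← hq0, ← heq]; exact e.map_source hsrc
  have hs0 : e.symm 0 = zc := by rw [← hq0, ← heq, e.left_inv hsrc]
  have hall : ∀ᶠ z in 𝓝 zc, f z = a + σ * q z ^ k ∧ z ∉ P ∧ AnalyticAt ℂ q z ∧ deriv q z ≠ 0 := by
    filter_upwards [hqk, hP.isOpen_compl.mem_nhds hzc, hqa.eventually_analyticAt,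
      hqa.deriv.continuousAt.eventually_ne hdb] with z h1 h2 h3 h4
    exact ⟨h1, h2, h3, h4⟩
  have hc : ContinuousAt e.symm 0 := e.symm.continuousAt htg
  have htg' : ∀ᶠ w in 𝓝 (0:ℂ), w ∈ e.target := e.open_target.mem_nhds htg
  have hall' := htg'.and (hc.eventually (by rw [hs0]; exact hall))
  obtain ⟨ε, hε, hball⟩ := Metric.eventually_nhds_iff_ball.mp hall'
  have hsub : Metric.ball (0:ℂ) (min ε (1/2)) ⊆ Metric.ball 0 ε := Metric.ball_subset_ball (min_le_left _ _)
  refine ⟨e.symm, min ε (1/2), by positivity, (min_le_right _ _).trans_lt (by norm_num), ?_, ?_, hs0, ?_⟩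
  · intro w hw
    obtain ⟨h1, h2, h3, h4, h5⟩ := hball w (hsub hw)
    refine (si_liftdiff q e.symm id w h4 h5 (e.symm.continuousAt h1) differentiableAt_id ?_).differentiableWithinAt
    filter_upwards [e.open_target.mem_nhds h1] with x hx
    rw [← heq]; exact e.right_inv hx
  · intro w hw w' hw' h
    exact e.symm.injOn (hball w (hsub hw)).1 (hball w' (hsub hw')).1 h
  · intro w hw
    obtain ⟨h1, h2, h3, h4, h5⟩ := hball w (hsub hw)
    refine ⟨h3, ?_⟩
    rw [h2, ← heq, e.right_inv h1]

lemma si_locHomeo (f : ℂ → ℂ) (P : Set ℂ) (hP : IsClosed P) (hfa : ∀ z ∉ P, AnalyticAt ℂ f z) :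
    IsLocalHomeomorph (fun z : {z : ℂ // z ∉ P ∧ deriv f z ≠ 0} => f z) := by
  have hopen : IsOpen {z : ℂ | z ∉ P ∧ deriv f z ≠ 0} := by
    rw [isOpen_iff_mem_nhds]
    rintro z ⟨h1, h2⟩
    filter_upwards [hP.isOpen_compl.mem_nhds h1, (hfa z h1).deriv.continuousAt.eventually_ne h2] with x h3 h4
    exact ⟨h3, h4⟩
  have h1 : IsLocalHomeomorphOn f {z : ℂ | z ∉ P ∧ deriv f z ≠ 0} := by
    intro z hz
    obtain ⟨e, he, _, hef⟩ := si_localinv f P hP hfa z hz.1 hz.2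
    exact ⟨e, he, hef.symm⟩
  have h2 := hopen.isOpenEmbedding_subtypeVal.isLocalHomeomorph
  rw [isLocalHomeomorph_iff_isLocalHomeomorphOn_univ] at h2 ⊢
  exact h1.comp h2 (fun x _ => x.2)

/-- punctured disc -/
abbrev SiA := {w : ℂ // 0 < ‖w‖ ∧ ‖w‖ < 1}

lemma si_global (f : ℂ → ℂ) (P : Set ℂ) (hP : IsClosed P) (hfa : ∀ z ∉ P, AnalyticAt ℂ f z)
    (hpole : ∀ p ∈ P, Tendsto (fun z => ‖f z‖) (𝓝[Pᶜ] p) atTop)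
    (a : ℂ) (σ : ℝ) (hσ : 0 < σ)
    (hcrit : ∀ z ∉ P, f z ∈ {v | v ≠ a ∧ ‖v - a‖ < σ} → deriv f z ≠ 0)
    (hasym : ∀ v ∈ {v | v ≠ a ∧ ‖v - a‖ < σ}, ∀ γ : ℝ → ℂ, ContinuousOn γ (Ici 0) →
      Tendsto (fun t => ‖γ t‖) atTop atTop →
      (∀ t, 0 ≤ t → γ t ∉ P) → Tendsto (fun t => f (γ t)) atTop (𝓝 v) → False)
    (k : ℕ) (hk : 1 ≤ k) (h₀ : ℂ → ℂ) (ε : ℝ) (hε : 0 < ε) (hε1 : ε < 1)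
    (hd₀ : DifferentiableOn ℂ h₀ (Metric.ball 0 ε)) (hi₀ : InjOn h₀ (Metric.ball 0 ε))
    (hl₀ : ∀ w ∈ Metric.ball (0:ℂ) ε, h₀ w ∉ P ∧ f (h₀ w) = a + σ * w ^ k) :
    ∃ h : ℂ → ℂ, DifferentiableOn ℂ h (Metric.ball 0 1) ∧ InjOn h (Metric.ball 0 1) ∧
      h 0 = h₀ 0 ∧ ∀ w ∈ Metric.ball (0:ℂ) 1, h w ∉ P ∧ f (h w) = a + σ * w ^ k := by
  have hσ' : (σ:ℂ) ≠ 0 := by exact_mod_cast hσ.ne'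
  set N : Set ℂ := {v | v ≠ a ∧ ‖v - a‖ < σ} with hN
  have hNmem : ∀ w : ℂ, 0 < ‖w‖ → ‖w‖ < 1 → a + σ * w ^ k ∈ N := by
    intro w h1 h2
    have h3 : w ≠ 0 := norm_pos_iff.mp h1
    constructor
    · intro h
      have : (σ:ℂ) * w ^ k = 0 := by simpa using h
      exact mul_ne_zero hσ' (pow_ne_zero k h3) this
    · rw [add_sub_cancel_left, norm_mul, norm_pow, Complex.norm_real, Real.norm_of_nonneg hσ.le]
      have : ‖w‖ ^ k < 1 := pow_lt_one₀ (norm_nonneg _) h2 (by omega)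
      nlinarith
  set sc : ℝ → ℂ → ℂ := fun t w => (((1 - t) * (ε/2 / ‖w‖) + t : ℝ) : ℂ) * w with hsc
  have hscn : ∀ t ∈ Icc (0:ℝ) 1, ∀ w : ℂ, 0 < ‖w‖ → ‖sc t w‖ = (1 - t) * (ε/2) + t * ‖w‖ := by
    intro t ht w hw
    have h1 : 0 ≤ (1 - t) * (ε/2 / ‖w‖) + t := by
      have : 0 ≤ 1 - t := by linarith [ht.2]
      have := ht.1
      positivity
    simp only [hsc]
    rw [norm_mul, Complex.norm_real, Real.norm_of_nonneg h1]
    field_simp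
  have hscpos : ∀ t ∈ Icc (0:ℝ) 1, ∀ w : ℂ, 0 < ‖w‖ → 0 < ‖sc t w‖ := by
    intro t ht w hw
    rw [hscn t ht w hw]
    rcases eq_or_lt_of_le ht.1 with h | h
    · subst h; simp; linarith
    · have : 0 ≤ 1 - t := by linarith [ht.2]
      positivity
  have hsclt : ∀ t ∈ Icc (0:ℝ) 1, ∀ w : ℂ, 0 < ‖w‖ → ∀ c, ‖w‖ < c → ε/2 < c → ‖sc t w‖ < c := by
    intro t ht w hw c h1 h2
    rw [hscn t ht w hw]
    rcases eq_or_lt_of_le ht.1 with h | h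
    · subst h; simp; linarith
    · have : 0 ≤ 1 - t := by linarith [ht.2]
      nlinarith
  have hsc0 : ∀ w : ℂ, 0 < ‖w‖ → sc 0 w ∈ Metric.ball (0:ℂ) ε := by
    intro w hw
    rw [mem_ball_zero_iff, hscn 0 (by simp) w hw]; simp; linarith
  have hscc : ∀ w, Continuous (fun t => sc t w) := by
    intro w; simp only [hsc]; fun_prop
  have hc₀ : ContinuousOn h₀ (Metric.ball 0 ε) := hd₀.continuousOn
  -- path lifts
  have hpl : ∀ w : ℂ, 0 < ‖w‖ → ‖w‖ < 1 →
      ∃ γ, SiLift f P (fun t => a + σ * (sc t w) ^ k) (h₀ (sc 0 w)) 1 γ := by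
    intro w h1 h2
    have hb := hl₀ _ (hsc0 w h1)
    apply si_pathlift f P hP hfa hpole N hcrit hasym
    · have := hscc w
      fun_prop
    · intro t ht
      exact hNmem _ (hscpos t ht w h1) (hsclt t ht w h1 1 h2 (by linarith))
    · exact hb.1
    · exact hb.2
  choose! γ hγ using hpl
  have hγN : ∀ w : ℂ, 0 < ‖w‖ → ‖w‖ < 1 → ∀ t ∈ Icc (0:ℝ) 1, γ w t ∉ P ∧ deriv f (γ w t) ≠ 0 := by
    intro w h1 h2 t ht
    have := (hγ w h1 h2).2.2 t ht
    refine ⟨this.1, hcrit _ this.1 ?_⟩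
    rw [this.2]
    exact hNmem _ (hscpos t ht w h1) (hsclt t ht w h1 1 h2 (by linarith))
  have hcontΓ : Continuous (fun x : unitInterval × SiA =>
      (⟨γ x.2.1 x.1, hγN x.2.1 x.2.2.1 x.2.2.2 x.1 x.1.2⟩ : {z : ℂ // z ∉ P ∧ deriv f z ≠ 0})) := by
    have hFc : Continuous (fun x : unitInterval × SiA => a + σ * (sc x.1 x.2.1) ^ k) := by
      simp only [hsc]
      have : Continuous (fun x : unitInterval × SiA => ε / 2 / ‖x.2.1‖) := by
        apply Continuous.div continuous_const (by fun_prop)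
        intro x; exact x.2.2.1.ne'
      fun_prop
    refine (si_locHomeo f P hP hfa).continuous_lift (T2Space.isSeparatedMap _) ⟨_, hFc⟩ ?_ ?_ ?_
    · ext x
      exact ((hγ x.2.1 x.2.2.1 x.2.2.2).2.2 x.1 x.1.2).2
    · refine Continuous.subtype_mk ?_ _
      have h3 : Continuous (fun w : SiA => h₀ (sc 0 w.1)) := by
        refine hc₀.comp_continuous ?_ (fun w => hsc0 w.1 w.2.1)
        simp only [hsc]
        have : Continuous (fun x : SiA => ε / 2 / ‖x.1‖) := by
          apply Continuous.div continuous_const (by fun_prop)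
          intro x; exact x.2.1.ne'
        fun_prop
      refine h3.congr ?_
      intro w
      exact (hγ w.1 w.2.1 w.2.2).2.1.symm
    · intro w
      refine Continuous.subtype_mk ?_ _
      exact (hγ w.1 w.2.1 w.2.2).1.comp_continuous continuous_subtype_val (fun t => t.2)
  have hcont1 : Continuous (fun w : SiA => γ w.1 1) := by
    have h3 : Continuous (fun w : SiA => ((1 : unitInterval), w)) := by fun_prop
    exact continuous_subtype_val.comp (hcontΓ.comp h3)
  have hAopen : IsOpen {w : ℂ | 0 < ‖w‖ ∧ ‖w‖ < 1} :=
    (isOpen_lt continuous_const continuous_norm).inter (isOpen_lt continuous_norm continuous_const)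
  have hcontγ : ContinuousOn (fun w => γ w 1) {w : ℂ | 0 < ‖w‖ ∧ ‖w‖ < 1} := by
    rw [continuousOn_iff_continuous_domRestrict]; exact hcont1
  have hsc1 : ∀ w, sc 1 w = w := by intro w; simp [hsc]
  have hγ1 : ∀ w : ℂ, 0 < ‖w‖ → ‖w‖ < 1 → f (γ w 1) = a + σ * w ^ k := by
    intro w h1 h2
    have := ((hγ w h1 h2).2.2 1 (by simp)).2
    rw [this]
    show a + σ * (sc 1 w) ^ k = _
    rw [hsc1]
  have hγ0 : ∀ w : ℂ, 0 < ‖w‖ → ‖w‖ < ε → γ w 1 = h₀ w := by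
    intro w h1 h2
    have h3 : ‖w‖ < 1 := h2.trans hε1
    have hm : ∀ t ∈ Icc (0:ℝ) 1, sc t w ∈ Metric.ball (0:ℂ) ε := by
      intro t ht
      rw [mem_ball_zero_iff]; exact hsclt t ht w h1 ε h2 (by linarith)
    have := si_uniq f P hP hfa (isPreconnected_Icc (a := (0:ℝ)) (b := 1)) (γ w) (fun t => h₀ (sc t w))
      (hγ w h1 h3).1 (hc₀.comp (hscc w).continuousOn hm) (hγN w h1 h3) (by
        intro s hs
        rw [((hγ w h1 h3).2.2 s hs).2, (hl₀ _ (hm s hs)).2]) 0 (by simp) (hγ w h1 h3).2.1 1 (by simp)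
    rw [this]
    show h₀ (sc 1 w) = _
    rw [hsc1]
  classical
  set h : ℂ → ℂ := fun w => if w = 0 then h₀ 0 else γ w 1 with hh
  have hne : ∀ w, 0 < ‖w‖ → h w = γ w 1 := by
    intro w hw; simp [hh, norm_pos_iff.mp hw]
  have hhε : ∀ w ∈ Metric.ball (0:ℂ) ε, h w = h₀ w := by
    intro w hw
    rw [mem_ball_zero_iff] at hw
    by_cases h0 : w = 0
    · simp [hh, h0]
    · rw [hne w (norm_pos_iff.mpr h0), hγ0 w (norm_pos_iff.mpr h0) hw]
  have hhl : ∀ w ∈ Metric.ball (0:ℂ) 1, h w ∉ P ∧ f (h w) = a + σ * w ^ k := by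
    intro w hw
    rw [mem_ball_zero_iff] at hw
    by_cases h0 : w = 0
    · have hm : w ∈ Metric.ball (0:ℂ) ε := by simp [h0, hε]
      rw [hhε w hm]; exact hl₀ w hm
    · have h1 := norm_pos_iff.mpr h0
      rw [hne w h1]
      exact ⟨(hγN w h1 hw 1 (by simp)).1, hγ1 w h1 hw⟩
  have hdiff : DifferentiableOn ℂ h (Metric.ball 0 1) := by
    intro w hw
    apply DifferentiableAt.differentiableWithinAt
    by_cases h0 : w = 0
    · have hm : Metric.ball (0:ℂ) ε ∈ 𝓝 w := Metric.isOpen_ball.mem_nhds (by simp [h0, hε])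
      refine ((hd₀ w (mem_of_mem_nhds hm)).differentiableAt hm).congr_of_eventuallyEq ?_
      filter_upwards [hm] with x hx using hhε x hx
    · rw [mem_ball_zero_iff] at hw
      have h1 := norm_pos_iff.mpr h0
      have hn := hAopen.mem_nhds (show w ∈ {w : ℂ | 0 < ‖w‖ ∧ ‖w‖ < 1} from ⟨h1, hw⟩)
      have hev : h =ᶠ[𝓝 w] (fun w => γ w 1) := by
        filter_upwards [hn] with x hx using hne x hx.1
      refine DifferentiableAt.congr_of_eventuallyEq ?_ hev
      have hz := hγN w h1 hw 1 (by simp)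
      refine si_liftdiff f (fun w => γ w 1) (fun w => a + σ * w ^ k) w (hfa _ hz.1) hz.2
        (hcontγ.continuousAt hn) (by fun_prop) ?_
      filter_upwards [hn] with x hx using hγ1 x hx.1 hx.2
  refine ⟨h, hdiff, ?_, hhε 0 (by simp [hε]), hhl⟩
  intro w hw w' hw' heq
  have hpow : w ^ k = w' ^ k := by
    have h1 := (hhl w hw).2
    rw [heq, (hhl w' hw').2] at h1
    exact (mul_left_cancel₀ hσ' (add_left_cancel h1)).symm
  have hk0 : k ≠ 0 := by omega
  by_cases h0 : w = 0
  · rw [h0, zero_pow hk0] at hpow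
    rw [h0, eq_zero_of_pow_eq_zero hpow.symm]
  have hn : ‖w‖ = ‖w'‖ := by
    have : ‖w‖ ^ k = ‖w'‖ ^ k := by rw [← norm_pow, ← norm_pow, hpow]
    exact (pow_left_inj₀ (norm_nonneg _) (norm_nonneg _) hk0).mp this
  have hwp := norm_pos_iff.mpr h0
  rw [mem_ball_zero_iff] at hw hw'
  have hmm : ∀ u : ℂ, ‖u‖ < 1 → ∀ s ∈ Ioc (0:ℝ) 1, (s:ℂ) * u ∈ Metric.ball (0:ℂ) 1 := by
    intro u hu s hs
    rw [mem_ball_zero_iff, norm_mul, Complex.norm_real, Real.norm_of_nonneg hs.1.le]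
    nlinarith [hs.1, hs.2, norm_nonneg u]
  have hcc : ∀ u : ℂ, ‖u‖ < 1 → ContinuousOn (fun s : ℝ => h ((s:ℂ) * u)) (Ioc 0 1) := by
    intro u hu
    exact hdiff.continuousOn.comp (by fun_prop) (hmm u hu)
  have hall := si_uniq f P hP hfa (isPreconnected_Ioc (a := (0:ℝ)) (b := 1)) (fun s : ℝ => h ((s:ℂ) * w))
    (fun s : ℝ => h ((s:ℂ) * w')) (hcc w hw) (hcc w' hw') (by
      intro s hs
      have h1 := hmm w hw s hs
      have h2 := hhl _ h1
      refine ⟨h2.1, hcrit _ h2.1 ?_⟩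
      rw [h2.2]
      refine hNmem _ ?_ (mem_ball_zero_iff.mp h1)
      rw [norm_mul, Complex.norm_real, Real.norm_of_nonneg hs.1.le]
      exact mul_pos hs.1 hwp) (by
      intro s hs
      rw [(hhl _ (hmm w hw s hs)).2, (hhl _ (hmm w' hw' s hs)).2, mul_pow, mul_pow, hpow]) 1 (by simp) (by
      simpa using heq)
  have hs2 : ε / 2 ∈ Ioc (0:ℝ) 1 := ⟨by linarith, by linarith⟩
  have hsm : ∀ u : ℂ, ‖u‖ < 1 → ((ε/2 : ℝ):ℂ) * u ∈ Metric.ball (0:ℂ) ε := by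
    intro u hu
    rw [mem_ball_zero_iff, norm_mul, Complex.norm_real, Real.norm_of_nonneg hs2.1.le]
    nlinarith [norm_nonneg u]
  have : h (((ε/2 : ℝ):ℂ) * w) = h (((ε/2 : ℝ):ℂ) * w') := hall _ hs2
  rw [hhε _ (hsm w hw), hhε _ (hsm w' hw')] at this
  have := hi₀ (hsm w hw) (hsm w' hw') this
  exact mul_left_cancel₀ (by exact_mod_cast hs2.1.ne') this

lemma si_comp (f : ℂ → ℂ) (P : Set ℂ) (hfa : ∀ z ∉ P, AnalyticAt ℂ f z)
    (a : ℂ) (σ : ℝ) (hσ : 0 < σ) (k : ℕ) (hk : 1 ≤ k) (h : ℂ → ℂ)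
    (hd : DifferentiableOn ℂ h (Metric.ball 0 1)) (hi : InjOn h (Metric.ball 0 1))
    (hl : ∀ w ∈ Metric.ball (0:ℂ) 1, h w ∉ P ∧ f (h w) = a + σ * w ^ k)
    (s r : ℝ) (hr : 0 < r) (hr1 : r ≤ 1) (hrs : σ * r ^ k = s) (z : ℂ)
    (hz : z ∈ h '' Metric.ball 0 r) :
    connectedComponentIn {z : ℂ | z ∉ P ∧ ‖f z - a‖ < s} z = h '' Metric.ball 0 r ∧
      SimplyConnectedSpace ↥(h '' Metric.ball 0 r) := by
  have hsub : Metric.ball (0:ℂ) r ⊆ Metric.ball 0 1 := Metric.ball_subset_ball hr1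
  have hnorm : ∀ w ∈ Metric.ball (0:ℂ) 1, ‖f (h w) - a‖ = σ * ‖w‖ ^ k := by
    intro w hw
    rw [(hl w hw).2, add_sub_cancel_left, norm_mul, norm_pow, Complex.norm_real, Real.norm_of_nonneg hσ.le]
  have han : AnalyticOnNhd ℂ h (Metric.ball 0 1) := hd.analyticOnNhd Metric.isOpen_ball
  have hopen : ∀ s ⊆ Metric.ball (0:ℂ) 1, IsOpen s → IsOpen (h '' s) := by
    rcases han.is_constant_or_isOpen (convex_ball (0:ℂ) 1).isPreconnected with ⟨w, hw⟩ | h1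
    · exfalso
      have m1 : (0:ℂ) ∈ Metric.ball (0:ℂ) 1 := by simp
      have m2 : (1/2:ℂ) ∈ Metric.ball (0:ℂ) 1 := by
        rw [mem_ball_zero_iff]; norm_num
      have := hi m1 m2 ((hw _ m1).trans (hw _ m2).symm)
      norm_num at this
    · exact h1
  have hTU : h '' Metric.ball 0 r ⊆ {z : ℂ | z ∉ P ∧ ‖f z - a‖ < s} := by
    rintro _ ⟨w, hw, rfl⟩
    refine ⟨(hl w (hsub hw)).1, ?_⟩
    rw [hnorm w (hsub hw), ← hrs]
    rw [mem_ball_zero_iff] at hw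
    exact mul_lt_mul_of_pos_left (pow_lt_pow_left₀ hw (norm_nonneg _) (by omega)) hσ
  have hTpre : IsPreconnected (h '' Metric.ball 0 r) :=
    (convex_ball (0:ℂ) r).isPreconnected.image h (hd.continuousOn.mono hsub)
  refine ⟨Subset.antisymm ?_ (hTpre.subset_connectedComponentIn hz hTU), ?_⟩
  · refine isPreconnected_connectedComponentIn.subset_of_closure_inter_subset
      (hopen _ hsub Metric.isOpen_ball) ⟨z, mem_connectedComponentIn (hTU hz), hz⟩ ?_
    rintro x ⟨hx, hxC⟩
    obtain ⟨hxP, hxs⟩ := connectedComponentIn_subset _ _ hxC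
    obtain ⟨c, hc1, hc2⟩ := exists_between hxs
    set K : Set ℂ := {w | ‖w‖ ≤ r ∧ σ * ‖w‖ ^ k ≤ c} with hK
    have hKb : K ⊆ Metric.ball 0 r := by
      rintro w ⟨h1, h2⟩
      rw [mem_ball_zero_iff]
      refine lt_of_le_of_ne h1 ?_
      intro h3
      rw [h3, hrs] at h2; linarith
    have hKc : IsCompact K := by
      have : K = Metric.closedBall 0 r ∩ {w | σ * ‖w‖ ^ k ≤ c} := by
        ext w; simp [hK]
      rw [this]
      exact (isCompact_closedBall _ _).inter_right (isClosed_le (by fun_prop) continuous_const)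
    have hKi : IsClosed (h '' K) :=
      (hKc.image_of_continuousOn (hd.continuousOn.mono (hKb.trans hsub))).isClosed
    have hx2 : x ∈ closure (h '' K) := by
      rw [mem_closure_iff_nhds] at hx ⊢
      intro t ht
      have hcont : ∀ᶠ y in 𝓝 x, ‖f y - a‖ < c :=
        ((hfa x hxP).continuousAt.sub continuousAt_const).norm.eventually_lt_const hc1
      obtain ⟨y, ⟨hyt, hyc⟩, w, hw, rfl⟩ := hx _ (inter_mem ht hcont)
      refine ⟨h w, hyt, w, ⟨(mem_ball_zero_iff.mp hw).le, ?_⟩, rfl⟩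
      have : ‖f (h w) - a‖ < c := hyc
      rw [hnorm w (hsub hw)] at this
      exact this.le
    rw [hKi.closure_eq] at hx2
    exact image_mono hKb hx2
  · have hemb : IsOpenEmbedding (fun w : Metric.ball (0:ℂ) r => h w) := by
      apply IsOpenEmbedding.of_continuous_injective_isOpenMap
      · exact continuousOn_iff_continuous_domRestrict.mp (hd.continuousOn.mono hsub)
      · intro x y hxy
        exact Subtype.ext (hi (hsub x.2) (hsub y.2) hxy)
      · intro U hU
        have := hopen (Subtype.val '' U) (by rintro _ ⟨x, _, rfl⟩; exact hsub x.2)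
          (Metric.isOpen_ball.isOpenMap_subtype_val U hU)
        rwa [image_image] at this
    have hrange : range (fun w : Metric.ball (0:ℂ) r => h w) = h '' Metric.ball 0 r := by
      ext x; simp
    have : ContractibleSpace (Metric.ball (0:ℂ) r) :=
      (convex_ball (0:ℂ) r).contractibleSpace ⟨0, by simp [hr]⟩
    rw [← hrange]
    have := (hemb.toIsEmbedding.toHomeomorph).symm.contractibleSpace
    infer_instance

lemma si_ord (f : ℂ → ℂ) (z₁ a : ℂ) (k : ℕ) (hk : 1 ≤ k) (G : ℂ → ℂ) (hG : AnalyticAt ℂ G z₁)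
    (hG0 : G z₁ ≠ 0) (hfG : ∀ᶠ z in 𝓝 z₁, f z = a + (z - z₁) ^ k * G z) :
    ∃ g : ℂ → ℂ, AnalyticAt ℂ g z₁ ∧ g z₁ ≠ 0 ∧
      ∀ᶠ z in 𝓝 z₁, deriv f z = (z - z₁) ^ (k - 1) * g z := by
  have hk0 : (k:ℂ) ≠ 0 := by exact_mod_cast (by omega : k ≠ 0)
  refine ⟨fun z => k * G z + (z - z₁) * deriv G z, ?_, ?_, ?_⟩
  · exact (analyticAt_const.mul hG).add ((analyticAt_id.sub analyticAt_const).mul hG.deriv)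
  · simp [hk0, hG0]
  · filter_upwards [hfG.eventually_nhds, hG.eventually_analyticAt] with z hz hz2
    rw [EventuallyEq.deriv_eq hz]
    have h1 : HasDerivAt (fun z : ℂ => z - z₁) 1 z := (hasDerivAt_id z).sub_const z₁
    have h2 := ((h1.pow k).mul hz2.differentiableAt.hasDerivAt).const_add a
    have h3 := h2.deriv
    refine Eq.trans h3 ?_
    obtain ⟨m, rfl⟩ : ∃ m, k = m + 1 := ⟨k - 1, by omega⟩
    simp only [Pi.pow_apply, add_tsub_cancel_right]
    push_cast
    ring

lemma si_closed (P : Set ℂ) (h : ∀ K : Set ℂ, IsCompact K → (P ∩ K).Finite) : IsClosed P := by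
  rw [← isOpen_compl_iff, isOpen_iff_mem_nhds]
  intro z hz
  have h1 := (h _ (isCompact_closedBall z 1)).isClosed.isOpen_compl.mem_nhds
    (show z ∈ (P ∩ Metric.closedBall z 1)ᶜ from fun hh => hz hh.1)
  filter_upwards [h1, Metric.closedBall_mem_nhds z one_pos] with x hx hx2 hxP
  exact hx ⟨hxP, hx2⟩

lemma si_compl_preconn (P : Set ℂ) (h : ∀ K : Set ℂ, IsCompact K → (P ∩ K).Finite) :
    IsPreconnected Pᶜ := by
  have hc : P.Countable := by
    have : P = ⋃ n : ℕ, P ∩ Metric.closedBall 0 n := by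
      ext z
      simp only [mem_iUnion, mem_inter_iff, mem_closedBall_zero_iff, exists_and_left]
      exact ⟨fun hz => ⟨hz, exists_nat_ge _⟩, fun hz => hz.1⟩
    rw [this]
    exact countable_iUnion fun n => (h _ (isCompact_closedBall _ _)).countable
  refine (hc.isPathConnected_compl_of_one_lt_rank ?_).isConnected.isPreconnected
  rw [Complex.rank_real_complex]; norm_num

lemma si_notconst (f : ℂ → ℂ) (P : Set ℂ) (hf : TranscMeroPlane f P) (z c : ℂ) (hz : z ∉ P) :
    ¬ ∀ᶠ x in 𝓝 z, f x = c := by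
  intro hev
  apply hf.2
  have h1 : AnalyticOnNhd ℂ f Pᶜ := fun x hx => hf.1.2.1 x hx
  have h2 := h1.eqOn_of_preconnected_of_eventuallyEq (g := fun _ => c) (fun _ _ => analyticAt_const)
    (si_compl_preconn P hf.1.1) hz hev
  exact ⟨Polynomial.C c, 1, one_ne_zero, fun x hx _ => by simpa using h2 hx⟩

lemma si_crit (f : ℂ → ℂ) (P : Set ℂ) (hf : TranscMeroPlane f P) (z : ℂ) (hz : z ∉ P)
    (hd : deriv f z = 0) : SingularValue f P (some (f z)) := by
  left
  obtain ⟨k, hk, ⟨G, hG, hG0, hfG⟩, _⟩ := si_local f P (si_closed P hf.1.1) z (f z) 1 one_pos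
    (hf.1.2.1 z hz) hz rfl (si_notconst f P hf z _ hz)
  obtain ⟨g, hg, hg0, hdg⟩ := si_ord f z (f z) k hk G hG hG0 hfG
  have hk1 : k ≠ 1 := by
    rintro rfl
    have := hdg.self_of_nhds
    rw [hd] at this
    simp at this
    exact hg0 this.symm
  refine ⟨z, ⟨k, by omega, Or.inr ⟨hf.1.2.1 z hz, by omega, g, hg, hg0, hdg⟩⟩, ?_⟩
  simp [valueAt, hz]

lemma si_asym (f : ℂ → ℂ) (P : Set ℂ) (v : ℂ) (γ : ℝ → ℂ) (h1 : ContinuousOn γ (Ici 0))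
    (h2 : Tendsto (fun t => ‖γ t‖) atTop atTop) (h3 : ∀ t, 0 ≤ t → γ t ∉ P)
    (h4 : Tendsto (fun t => f (γ t)) atTop (𝓝 v)) : SingularValue f P (some v) := by
  right
  refine ⟨γ, h1, h2, ?_⟩
  have h5 : Tendsto (fun t => ‖f (γ t) - v‖) atTop (𝓝 0) := by
    rwa [tendsto_iff_norm_sub_tendsto_zero] at h4
  refine squeeze_zero' ?_ ?_ h5
  · filter_upwards [eventually_ge_atTop 0] with t ht
    simp only [valueAt, h3 t ht, if_false, chordal]
    positivity
  · filter_upwards [eventually_ge_atTop 0] with t ht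
    simp only [valueAt, h3 t ht, if_false, chordal]
    apply div_le_self (norm_nonneg _)
    rw [Real.one_le_sqrt]
    nlinarith [sq_nonneg ‖f (γ t)‖, sq_nonneg ‖v‖, mul_nonneg (sq_nonneg ‖f (γ t)‖) (sq_nonneg ‖v‖)]

lemma si_all (f : ℂ → ℂ) (Pf : Set ℂ)
    (hf : TranscMeroPlane f Pf)
    (κ : ℕ) (a : Fin κ → ℂ) (σ : ℝ) (hσ : 0 < σ)
    (hsing : ∀ w : Option ℂ, SingularValue f Pf w → ∃ j, w = some (a j))
    (hsep : ∀ j j', a j ≠ a j' → 2 * σ ≤ ‖a j - a j'‖)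
    (M : ℕ) (hM : 0 < M)
    (hzeros : ∀ z m, z ∉ Pf → ZeroOrder (deriv f) z m → m ≤ M - 1) (j : Fin κ) (zc : ℂ)
    (hzc : zc ∉ Pf) (hfz : f zc = a j) :
    ∃ k : ℕ, 1 ≤ k ∧ k ≤ M ∧ ∃ h : ℂ → ℂ, DifferentiableOn ℂ h (Metric.ball 0 1) ∧
      InjOn h (Metric.ball 0 1) ∧
      h 0 = zc ∧ ∀ w ∈ Metric.ball (0:ℂ) 1, h w ∉ Pf ∧ f (h w) = a j + σ * w ^ k := by
  have hP := si_closed Pf hf.1.1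
  obtain ⟨k, hk, ⟨G, hG, hG0, hfG⟩, h₀, ε, hε, hε1, hd, hi, h00, hl⟩ := si_local f Pf hP zc (a j) σ hσ
    (hf.1.2.1 zc hzc) hzc hfz (si_notconst f Pf hf zc _ hzc)
  have hno : ∀ v, SingularValue f Pf (some v) → v ∈ {v | v ≠ a j ∧ ‖v - a j‖ < σ} → False := by
    rintro v hv ⟨h1, h2⟩
    obtain ⟨j', hj'⟩ := hsing _ hv
    have hj' : v = a j' := Option.some_injective _ hj'
    subst hj'
    have := hsep _ _ h1
    linarith
  obtain ⟨h, hd', hi', h0', hl'⟩ := si_global f Pf hP hf.1.2.1 hf.1.2.2 (a j) σ hσ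
    (fun z hz hm hd => hno _ (si_crit f Pf hf z hz hd) hm)
    (fun v hv γ h1 h2 h3 h4 => hno _ (si_asym f Pf v γ h1 h2 h3 h4) hv)
    k hk h₀ ε hε hε1 hd hi hl
  refine ⟨k, hk, ?_, h, hd', hi', h0'.trans h00, hl'⟩
  rcases eq_or_lt_of_le hk with h1 | h1
  · omega
  · obtain ⟨g, hg, hg0, hdg⟩ := si_ord f zc (a j) k hk G hG hG0 hfG
    have := hzeros zc (k - 1) hzc ⟨by omega, g, hg, hg0, hdg⟩
    omega

/-- Lemma 5.2: for `f` in the Speiser class with finite singular values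
`a₁, …, a_κ` that are `2σ`-separated, and all zeros of `f'` of multiplicity at most `M-1`,
a large point `z₀` with `|f(z₀) - a_j| < ρ`, lying in a component `F` of `{|f - a_j| < σ}`
with `a_j ∈ f(F)`, lies in a simply connected component `D ⊆ ℂ \ {0}` of `{|f - a_j| < ρ}`
of logarithmic diameter at most `16π(ρ/σ)^{1/M}`. -/
theorem speiser_small_island
    (f : ℂ → ℂ) (Pf : Set ℂ)
    (hf : TranscMeroPlane f Pf)
    (κ : ℕ) (a : Fin κ → ℂ) (σ : ℝ) (hσ : 0 < σ)
    (hsing : ∀ w : Option ℂ, SingularValue f Pf w → ∃ j, w = some (a j))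
    (hsep : ∀ j j', a j ≠ a j' → 2 * σ ≤ ‖a j - a j'‖)
    (M : ℕ) (hM : 0 < M)
    (hzeros : ∀ z m, z ∉ Pf → ZeroOrder (deriv f) z m → m ≤ M - 1) :
    ∃ ρ₀ : ℝ, 0 < ρ₀ ∧ ρ₀ ≤ σ ∧ ∀ ρ : ℝ, 0 < ρ → ρ < ρ₀ →
      ∃ Rρ : ℝ, 0 < Rρ ∧ ∀ z₀ : ℂ, ∀ j : Fin κ,
        Rρ < ‖z₀‖ → ‖f z₀ - a j‖ < ρ →
        (∃ zc ∈ connectedComponentIn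
            {z : ℂ | z ∉ Pf ∧ ‖f z - a j‖ < σ} z₀, f zc = a j) →
        (0 : ℂ) ∉ connectedComponentIn {z : ℂ | z ∉ Pf ∧ ‖f z - a j‖ < ρ} z₀ ∧
        SimplyConnectedSpace
          ↥(connectedComponentIn {z : ℂ | z ∉ Pf ∧ ‖f z - a j‖ < ρ} z₀) ∧
        ∀ u ∈ connectedComponentIn {z : ℂ | z ∉ Pf ∧ ‖f z - a j‖ < ρ} z₀,
          ∀ v ∈ connectedComponentIn {z : ℂ | z ∉ Pf ∧ ‖f z - a j‖ < ρ} z₀,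
            ‖Complex.log (u / v)‖ ≤ 16 * Real.pi * (ρ / σ) ^ (1 / (M : ℝ)) := by
  have hp20 : ((1:ℝ)/20) ^ M ≤ 1 := pow_le_one₀ (by norm_num) (by norm_num)
  refine ⟨σ * (1/20) ^ M, by positivity, by nlinarith, ?_⟩
  intro ρ hρ hρ0
  have hx0 : 0 < ρ / σ := by positivity
  have hx1 : ρ / σ ≤ (1/20) ^ M := by rw [div_le_iff₀ hσ]; linarith
  have hxM : (ρ / σ) ^ (1 / (M:ℝ)) ≤ 1/20 := by
    calc (ρ / σ) ^ (1 / (M:ℝ)) ≤ (((1:ℝ)/20) ^ M) ^ (1 / (M:ℝ)) :=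
          Real.rpow_le_rpow hx0.le hx1 (by positivity)
      _ = 1/20 := by
          rw [one_div (M:ℝ)]
          exact Real.pow_rpow_inv_natCast (by norm_num) (by omega)
  -- package
  have key : ∀ (j : Fin κ) (z₁ : ℂ), (∃ zc ∈ connectedComponentIn
      {z : ℂ | z ∉ Pf ∧ ‖f z - a j‖ < σ} z₁, f zc = a j) →
      ∃ (k : ℕ) (r : ℝ) (h : ℂ → ℂ), 1 ≤ k ∧ 0 < r ∧ r ≤ (ρ / σ) ^ (1 / (M:ℝ)) ∧ σ * r ^ k = ρ ∧
        DifferentiableOn ℂ h (Metric.ball 0 1) ∧ InjOn h (Metric.ball 0 1) ∧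
        (∀ w ∈ Metric.ball (0:ℂ) 1, h w ∉ Pf ∧ f (h w) = a j + σ * w ^ k) ∧
        connectedComponentIn {z : ℂ | z ∉ Pf ∧ ‖f z - a j‖ < σ} z₁ = h '' Metric.ball 0 1 ∧
        ∀ z ∈ connectedComponentIn {z : ℂ | z ∉ Pf ∧ ‖f z - a j‖ < σ} z₁, ‖f z - a j‖ < ρ →
          z ∈ h '' Metric.ball 0 r := by
    rintro j z₁ ⟨zc, hzc, hfz⟩
    obtain ⟨hzP, _⟩ := connectedComponentIn_subset _ _ hzc
    obtain ⟨k, hk, hkM, h, hd, hi, h0, hl⟩ :=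
      si_all f Pf hf κ a σ hσ hsing hsep M hM hzeros j zc hzP hfz
    have hk0 : (0:ℝ) < k := by exact_mod_cast hk
    have hrk : ((ρ / σ) ^ (1 / (k:ℝ))) ^ k = ρ / σ := by
      rw [one_div]; exact Real.rpow_inv_natCast_pow hx0.le (by omega)
    have hcomp : connectedComponentIn {z : ℂ | z ∉ Pf ∧ ‖f z - a j‖ < σ} z₁ = h '' Metric.ball 0 1 := by
      rw [connectedComponentIn_eq hzc]
      exact (si_comp f Pf hf.1.2.1 (a j) σ hσ k hk h hd hi hl σ 1 one_pos le_rfl (by simp) zc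
        ⟨0, by simp, h0⟩).1
    have hrpos : 0 < (ρ / σ) ^ (1 / (k:ℝ)) := by positivity
    refine ⟨k, (ρ / σ) ^ (1 / (k:ℝ)), h, hk, hrpos, ?_, ?_, hd, hi, hl, hcomp, ?_⟩
    · apply Real.rpow_le_rpow_of_exponent_ge hx0 (hx1.trans hp20)
      apply one_div_le_one_div_of_le hk0
      exact_mod_cast hkM
    · rw [hrk]; field_simp
    · intro z hz hzρ
      rw [hcomp] at hz
      obtain ⟨w, hw, rfl⟩ := hz
      refine ⟨w, ?_, rfl⟩
      rw [(hl w hw).2, add_sub_cancel_left, norm_mul, norm_pow, Complex.norm_real,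
        Real.norm_of_nonneg hσ.le] at hzρ
      rw [mem_ball_zero_iff]
      refine lt_of_pow_lt_pow_left₀ k hrpos.le ?_
      rw [hrk, lt_div_iff₀ hσ]; linarith
  have hB : ∀ j : Fin κ, ∃ B : ℝ, 0 ≤ B ∧ ∀ z₀, ‖f z₀ - a j‖ < ρ →
      (∃ zc ∈ connectedComponentIn {z : ℂ | z ∉ Pf ∧ ‖f z - a j‖ < σ} z₀, f zc = a j) →
      (0:ℂ) ∈ connectedComponentIn {z : ℂ | z ∉ Pf ∧ ‖f z - a j‖ < σ} z₀ → ‖z₀‖ ≤ B := by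
    intro j
    by_cases hex : ∃ zc ∈ connectedComponentIn {z : ℂ | z ∉ Pf ∧ ‖f z - a j‖ < σ} 0, f zc = a j
    · obtain ⟨k, r, h, hk, hr, hrM, hrs, hd, hi, hl, hcomp, hin⟩ := key j 0 hex
      have hsub : Metric.closedBall (0:ℂ) r ⊆ Metric.ball 0 1 :=
        Metric.closedBall_subset_ball (by linarith)
      obtain ⟨B, hB⟩ := ((isCompact_closedBall (0:ℂ) r).image_of_continuousOn
        (hd.continuousOn.mono hsub)).isBounded.exists_norm_le
      refine ⟨max B 0, le_max_right _ _, ?_⟩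
      intro z₀ hz hzc h0
      have hz₀ : z₀ ∈ connectedComponentIn {z : ℂ | z ∉ Pf ∧ ‖f z - a j‖ < σ} z₀ :=
        mem_connectedComponentIn (connectedComponentIn_nonempty_iff.mp ⟨0, h0⟩)
      have h1 := connectedComponentIn_eq h0
      rw [h1] at hz₀
      exact (hB _ (image_mono Metric.ball_subset_closedBall (hin z₀ hz₀ hz))).trans (le_max_left _ _)
    · refine ⟨0, le_rfl, ?_⟩
      intro z₀ hz hzc h0
      rw [connectedComponentIn_eq h0] at hzc
      exact absurd hzc hex
  choose B hB0 hB using hB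
  refine ⟨1 + ∑ j, B j, ?_, ?_⟩
  · have := Finset.sum_nonneg (fun j (_ : j ∈ Finset.univ) => hB0 j)
    linarith
  intro z₀ j hR hz hzc
  have h0F : (0:ℂ) ∉ connectedComponentIn {z : ℂ | z ∉ Pf ∧ ‖f z - a j‖ < σ} z₀ := by
    intro h0
    have h1 := hB j z₀ hz hzc h0
    have h2 := Finset.single_le_sum (fun j (_ : j ∈ Finset.univ) => hB0 j) (Finset.mem_univ j)
    linarith
  obtain ⟨k, r, h, hk, hr, hrM, hrs, hd, hi, hl, hcomp, hin⟩ := key j z₀ hzc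
  have hz₀ : z₀ ∈ connectedComponentIn {z : ℂ | z ∉ Pf ∧ ‖f z - a j‖ < σ} z₀ := by
    obtain ⟨zc, hzc, _⟩ := hzc
    exact mem_connectedComponentIn (connectedComponentIn_nonempty_iff.mp ⟨zc, hzc⟩)
  obtain ⟨hD, hsc⟩ := si_comp f Pf hf.1.2.1 (a j) σ hσ k hk h hd hi hl ρ r hr (by linarith) hrs z₀
    (hin z₀ hz₀ hz)
  rw [hcomp] at h0F
  have hne : ∀ z ∈ Metric.ball (0:ℂ) 1, h z ≠ 0 := fun z hz h0 => h0F ⟨z, hz, h0⟩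
  have hsub : Metric.ball (0:ℂ) r ⊆ Metric.ball 0 1 := Metric.ball_subset_ball (by linarith)
  rw [hD]
  refine ⟨fun h0 => h0F (image_mono hsub h0), hsc, ?_⟩
  rintro _ ⟨w, hw, rfl⟩ _ ⟨w', hw', rfl⟩
  have := si_logdist h hd hi hne r hr (by linarith) w w' (mem_ball_zero_iff.mp hw) (mem_ball_zero_iff.mp hw')
  refine this.trans ?_
  have := Real.pi_pos
  gcongr

end
end
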